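/- arXiv:1211.3531 — 2 statements merged into one kernel-verified Lean document; each statement's English description precedes it below -/
import Mathlib

section
/- Let M ⊆ ℝⁿ be open and connected and let X₁,…,X_k : M → ℝⁿ be smooth vector fields such that there are constants K and L with ‖Xᵢ(x)‖ ≤ K and ‖Xᵢ(x) − Xᵢ(y)‖ ≤ L‖x − y‖ for all x, y ∈ M and all i. Then there exists an open set 𝒰 ⊆ L¹([0,1];ℝ^k) × M containing {0} × M such that for every (u, x) ∈ 𝒰 the integral equation γ(t) = x + ∫₀ᵗ Σ_{i=1}^k uᵢ(s)·Xᵢ(γ(s)) ds (equivalently, γ'(t) = Σᵢ uᵢ(t)·Xᵢ(γ(t)) for almost every t with γ(0) = x) has a unique solution γ ∈ C([0,1]; M), and the map (u, x) ↦ γ is C^∞ (Fréchet smooth) from 𝒰 into the Banach space C([0,1]; ℝⁿ) with the supremum norm. -/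
noncomputable section
open MeasureTheory

/-- The Banach space `L¹([0,1]; ℝ^k)`. -/
abbrev LpOne (k : ℕ) : Type :=
  MeasureTheory.Lp (Fin k → ℝ) 1 ((volume : Measure ℝ).restrict (Set.Icc (0 : ℝ) 1))

/-- `γ ∈ C([0,1]; ℝⁿ)` solves the controlled ODE `γ' = ∑ᵢ uᵢ · Xᵢ ∘ γ`, `γ(0) = x`,
in integral form: `γ(t) = x + ∫₀ᵗ ∑ᵢ uᵢ(s) • Xᵢ(γ(s)) ds`. -/
def SolvesODE {n k : ℕ} (X : Fin k → (Fin n → ℝ) → (Fin n → ℝ)) (u : ℝ → Fin k → ℝ)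
    (x : Fin n → ℝ) (γ : C(Set.Icc (0 : ℝ) 1, Fin n → ℝ)) : Prop :=
  ∀ t : Set.Icc (0 : ℝ) 1,
    IntervalIntegrable
      (fun s => ∑ i, u s i • X i (γ (Set.projIcc 0 1 zero_le_one s))) volume 0 (t : ℝ) ∧
    γ t = x + ∫ s in (0 : ℝ)..(t : ℝ), ∑ i, u s i • X i (γ (Set.projIcc 0 1 zero_le_one s))


section Nemytskii
set_option linter.unusedSectionVars false
open Topology Filter
open scoped ContDiff

variable {T : Type} [TopologicalSpace T] [CompactSpace T]
  {E F : Type} [NormedAddCommGroup E] [NormedSpace ℝ E]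
  [NormedAddCommGroup F] [NormedSpace ℝ F]

open Classical in
/-- Superposition operator. -/
def nemOp (T : Type) [TopologicalSpace T] {E F : Type} [NormedAddCommGroup E]
    [NormedAddCommGroup F] (f : E → F) (γ : C(T, E)) : C(T, F) :=
  if h : Continuous (fun t => f (γ t)) then ⟨fun t => f (γ t), h⟩ else 0

lemma nemOp_apply {f : E → F} {M : Set E} (hf : ContinuousOn f M) {γ : C(T, E)}
    (hγ : ∀ t, γ t ∈ M) (t : T) : nemOp T f γ t = f (γ t) := by
  have h : Continuous (fun t => f (γ t)) := hf.comp_continuous γ.continuous hγ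
  simp [nemOp, h]

/-- Pointwise application as a bilinear map. -/
def evOp (T : Type) [TopologicalSpace T] [CompactSpace T]
    (E F : Type) [NormedAddCommGroup E] [NormedSpace ℝ E]
    [NormedAddCommGroup F] [NormedSpace ℝ F] :
    C(T, E →L[ℝ] F) →L[ℝ] (C(T, E) →L[ℝ] C(T, F)) :=
  LinearMap.mkContinuous₂
    (LinearMap.mk₂ ℝ (fun (φ : C(T, E →L[ℝ] F)) (h : C(T, E)) =>
        (⟨fun t => φ t (h t), φ.continuous.clm_apply h.continuous⟩ : C(T, F)))
      (by intros; ext; simp) (by intros; ext; simp) (by intros; ext; simp) (by intros; ext; simp))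
    1 (by
      intro φ h
      rw [ContinuousMap.norm_le _ (by positivity)]
      intro t
      simp only [LinearMap.mk₂_apply, ContinuousMap.coe_mk, one_mul]
      exact (φ t).le_of_opNorm_le_of_le (φ.norm_coe_le_norm t) (h.norm_coe_le_norm t))

lemma evOp_apply (φ : C(T, E →L[ℝ] F)) (h : C(T, E)) (t : T) : evOp T E F φ h t = φ t (h t) := rfl

lemma isOpen_curves {M : Set E} (hM : IsOpen M) : IsOpen {γ : C(T, E) | ∀ t, γ t ∈ M} := by
  have := ContinuousMap.isOpen_setOfPred_mapsTo (X := T) (Y := E) isCompact_univ hM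
  simpa [Set.MapsTo] using this

lemma nemOp_hasFDerivAt {f : E → F} {M : Set E} (hM : IsOpen M) (hf : ContDiffOn ℝ 1 f M)
    {γ : C(T, E)} (hγ : ∀ t, γ t ∈ M) :
    HasFDerivAt (nemOp T f) (evOp T E F (nemOp T (fderiv ℝ f) γ)) γ := by
  have hf' : ContinuousOn (fderiv ℝ f) M := hf.continuousOn_fderiv_of_isOpen hM le_rfl
  have hd : ∀ x ∈ M, HasFDerivAt f (fderiv ℝ f x) x := fun x hx =>
    ((hf.differentiableOn (by simp)).differentiableAt (hM.mem_nhds hx)).hasFDerivAt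
  rw [hasFDerivAt_iff_isLittleO, Asymptotics.isLittleO_iff]
  intro c hc
  have hK : IsCompact (Set.range γ) := isCompact_range γ.continuous
  have hKM : Set.range γ ⊆ M := by rintro _ ⟨t, rfl⟩; exact hγ t
  have h1 := hK.uniformContinuousAt_of_continuousAt (fderiv ℝ f)
    (fun a ha => hf'.continuousAt (hM.mem_nhds (hKM ha))) (Metric.dist_mem_uniformity hc)
  obtain ⟨δ₁, hδ₁, h1⟩ := Metric.mem_uniformity_dist.1 h1
  obtain ⟨δ₂, hδ₂, h2⟩ := hK.exists_thickening_subset_open hM hKM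
  filter_upwards [Metric.ball_mem_nhds γ (lt_min hδ₁ hδ₂)] with η hη
  rw [Metric.mem_ball] at hη
  have hball : ∀ t, Metric.ball (γ t) (min δ₁ δ₂) ⊆ M := by
    intro t y hy
    apply h2
    rw [Metric.mem_thickening_iff]
    exact ⟨γ t, ⟨t, rfl⟩, lt_of_lt_of_le hy (min_le_right _ _)⟩
  have hηb : ∀ t, η t ∈ Metric.ball (γ t) (min δ₁ δ₂) := fun t =>
    lt_of_le_of_lt (ContinuousMap.dist_apply_le_dist t) hη
  have hηM : ∀ t, η t ∈ M := fun t => hball t (hηb t)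
  rw [ContinuousMap.norm_le _ (by positivity)]
  intro t
  simp only [ContinuousMap.sub_apply, evOp_apply]
  rw [nemOp_apply hf.continuousOn hηM, nemOp_apply hf.continuousOn hγ, nemOp_apply hf' hγ]
  have := (convex_ball (γ t) (min δ₁ δ₂)).norm_image_sub_le_of_norm_hasFDerivWithin_le'
    (f := f) (f' := fderiv ℝ f) (φ := fderiv ℝ f (γ t)) (C := c) (x := γ t) (y := η t)
    (fun x hx => (hd x (hball t hx)).hasFDerivWithinAt)
    (fun x hx => by
      have := h1 (a := γ t) (b := x)
        (by rw [dist_comm]; exact lt_of_lt_of_le hx (min_le_left _ _)) ⟨t, rfl⟩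
      rw [← dist_eq_norm, dist_comm]
      exact le_of_lt this)
    (Metric.mem_ball_self (lt_min hδ₁ hδ₂)) (hηb t)
  refine this.trans ?_
  gcongr
  exact (η - γ).norm_coe_le_norm t

lemma nemOp_contDiffOn_nat {M : Set E} (hM : IsOpen M) (m : ℕ) :
    ∀ {F : Type} [NormedAddCommGroup F] [NormedSpace ℝ F] {f : E → F},
    ContDiffOn ℝ ∞ f M → ContDiffOn ℝ m (nemOp T f) {γ : C(T, E) | ∀ t, γ t ∈ M} := by
  induction m with
  | zero =>
    intro F _ _ f hf
    rw [Nat.cast_zero, contDiffOn_zero]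
    exact fun γ hγ => (nemOp_hasFDerivAt hM (hf.of_le (by simp)) hγ).continuousAt.continuousWithinAt
  | succ m ih =>
    intro F _ _ f hf
    rw [Nat.cast_succ, contDiffOn_succ_iff_fderiv_of_isOpen (isOpen_curves hM)]
    have hd := fun (γ : C(T, E)) (hγ : ∀ t, γ t ∈ M) =>
      nemOp_hasFDerivAt hM (hf.of_le (by simp)) hγ
    refine ⟨fun γ hγ => (hd γ hγ).differentiableAt.differentiableWithinAt, by simp, ?_⟩
    have h1 : ContDiffOn ℝ ∞ (fderiv ℝ f) M := hf.fderiv_of_isOpen hM (by simp)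
    have h2 := (evOp T E F).contDiff.comp_contDiffOn (ih h1)
    exact h2.congr (fun γ hγ => (hd γ hγ).fderiv)

lemma nemOp_contDiffOn {M : Set E} (hM : IsOpen M) {f : E → F} (hf : ContDiffOn ℝ ∞ f M) :
    ContDiffOn ℝ ∞ (nemOp T f) {γ : C(T, E) | ∀ t, γ t ∈ M} :=
  contDiffOn_infty.2 fun m => nemOp_contDiffOn_nat hM m hf

end Nemytskii

section Control

lemma coe_integrable {k : ℕ} (u : LpOne k) : IntegrableOn (⇑u) (Set.Icc (0 : ℝ) 1) volume :=
  L1.integrable_coeFn u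

lemma sum_norm_le {n k : ℕ} (a : Fin k → ℝ) (b : Fin k → Fin n → ℝ) :
    ‖∑ i, a i • b i‖ ≤ k * (‖a‖ * ‖b‖) := by
  refine (norm_sum_le _ _).trans ?_
  calc ∑ i, ‖a i • b i‖ ≤ ∑ _i : Fin k, ‖a‖ * ‖b‖ := by
        refine Finset.sum_le_sum fun i _ => ?_
        rw [norm_smul]
        gcongr
        · exact norm_le_pi_norm a i
        · exact norm_le_pi_norm b i
    _ = k * (‖a‖ * ‖b‖) := by simp

lemma ctrl_integrable {n k : ℕ} (u : LpOne k) (G : C(Set.Icc (0 : ℝ) 1, Fin k → Fin n → ℝ)) :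
    IntegrableOn (fun s => ∑ i, u s i • G (Set.projIcc 0 1 zero_le_one s) i)
      (Set.Icc (0 : ℝ) 1) volume := by
  have hG : Continuous (fun s : ℝ => G (Set.projIcc 0 1 zero_le_one s)) :=
    G.continuous.comp continuous_projIcc
  refine Integrable.mono' (g := fun s => k * (‖u s‖ * ‖G‖))
    (((coe_integrable u).norm.mul_const _).const_mul _) ?_ ?_
  · refine Finset.aestronglyMeasurable_fun_sum _ fun i _ => ?_
    have h1 : AEStronglyMeasurable (fun s => u s i) (volume.restrict (Set.Icc (0 : ℝ) 1)) :=
      (continuous_apply i).comp_aestronglyMeasurable (coe_integrable u).aestronglyMeasurable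
    exact h1.smul ((continuous_apply i).comp hG).aestronglyMeasurable
  · refine Filter.Eventually.of_forall fun s => ?_
    refine (sum_norm_le _ _).trans ?_
    gcongr
    exact G.norm_coe_le_norm _

lemma ctrl_intervalIntegrable {n k : ℕ} (u : LpOne k)
    (G : C(Set.Icc (0 : ℝ) 1, Fin k → Fin n → ℝ)) (t : Set.Icc (0 : ℝ) 1) :
    IntervalIntegrable (fun s => ∑ i, u s i • G (Set.projIcc 0 1 zero_le_one s) i)
      volume 0 (t : ℝ) := by
  rw [intervalIntegrable_iff_integrableOn_Icc_of_le t.2.1]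
  exact (ctrl_integrable u G).mono_set (Set.Icc_subset_Icc_right t.2.2)

lemma ctrl_continuous {n k : ℕ} (u : LpOne k) (G : C(Set.Icc (0 : ℝ) 1, Fin k → Fin n → ℝ)) :
    Continuous (fun t : Set.Icc (0 : ℝ) 1 =>
      ∫ s in (0 : ℝ)..(t : ℝ), ∑ i, u s i • G (Set.projIcc 0 1 zero_le_one s) i) := by
  have h := intervalIntegral.continuousOn_primitive_interval (a := (0 : ℝ)) (b := 1)
    (μ := volume) (f := fun s => ∑ i, u s i • G (Set.projIcc 0 1 zero_le_one s) i)
    (by rw [Set.uIcc_of_le zero_le_one]; exact ctrl_integrable u G)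
  rw [Set.uIcc_of_le zero_le_one] at h
  exact continuousOn_iff_continuous_domRestrict.1 h

lemma ctrl_bound {n k : ℕ} (u : LpOne k) (G : C(Set.Icc (0 : ℝ) 1, Fin k → Fin n → ℝ))
    (t : Set.Icc (0 : ℝ) 1) :
    ‖∫ s in (0 : ℝ)..(t : ℝ), ∑ i, u s i • G (Set.projIcc 0 1 zero_le_one s) i‖ ≤
      k * ‖u‖ * ‖G‖ := by
  have hu := (coe_integrable u).norm
  have hn : ‖u‖ = ∫ s in Set.Icc (0 : ℝ) 1, ‖u s‖ := L1.norm_eq_integral_norm u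
  have hint : IntegrableOn (fun s => k * (‖u s‖ * ‖G‖)) (Set.Icc (0 : ℝ) 1) volume :=
    (hu.mul_const _).const_mul _
  rw [intervalIntegral.integral_of_le t.2.1]
  calc _ ≤ ∫ s in Set.Ioc (0 : ℝ) t, k * (‖u s‖ * ‖G‖) := by
        refine norm_integral_le_of_norm_le
          (hint.mono_set (fun s hs => ⟨hs.1.le, hs.2.trans t.2.2⟩)) ?_
        refine Filter.Eventually.of_forall fun s => (sum_norm_le _ _).trans ?_
        gcongr
        exact G.norm_coe_le_norm _
    _ ≤ ∫ s in Set.Icc (0 : ℝ) 1, k * (‖u s‖ * ‖G‖) := by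
        refine setIntegral_mono_set hint
          (Filter.Eventually.of_forall fun s => by positivity) ?_
        exact Filter.Eventually.of_forall fun s hs => ⟨hs.1.le, hs.2.trans t.2.2⟩
    _ = k * ‖u‖ * ‖G‖ := by
        rw [integral_const_mul, integral_mul_const, hn, mul_assoc]

/-- The bilinear map `(u, G) ↦ ∫₀ᵗ ∑ᵢ uᵢ Gᵢ`. -/
def ctrlOp (n k : ℕ) : LpOne k →L[ℝ] (C(Set.Icc (0 : ℝ) 1, Fin k → Fin n → ℝ) →L[ℝ]
    C(Set.Icc (0 : ℝ) 1, Fin n → ℝ)) :=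
  LinearMap.mkContinuous₂
    (LinearMap.mk₂ ℝ (fun (u : LpOne k) (G : C(Set.Icc (0 : ℝ) 1, Fin k → Fin n → ℝ)) =>
        (⟨_, ctrl_continuous u G⟩ : C(Set.Icc (0 : ℝ) 1, Fin n → ℝ)))
      (by
        intro u v G
        refine ContinuousMap.ext fun t => ?_
        simp only [ContinuousMap.coe_mk, ContinuousMap.add_apply]
        rw [← intervalIntegral.integral_add (ctrl_intervalIntegrable u G t)
          (ctrl_intervalIntegrable v G t)]
        refine intervalIntegral.integral_congr_ae ?_
        have h := (ae_restrict_iff' measurableSet_Icc).1 (Lp.coeFn_add u v)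
        filter_upwards [h] with s hs hst
        rw [Set.uIoc_of_le t.2.1] at hst
        rw [hs ⟨hst.1.le, hst.2.trans t.2.2⟩]
        simp [add_smul, Finset.sum_add_distrib])
      (by
        intro c u G
        refine ContinuousMap.ext fun t => ?_
        simp only [ContinuousMap.coe_mk, ContinuousMap.smul_apply]
        rw [← intervalIntegral.integral_smul]
        refine intervalIntegral.integral_congr_ae ?_
        have h := (ae_restrict_iff' measurableSet_Icc).1 (Lp.coeFn_smul c u)
        filter_upwards [h] with s hs hst
        rw [Set.uIoc_of_le t.2.1] at hst
        rw [hs ⟨hst.1.le, hst.2.trans t.2.2⟩]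
        simp [Finset.smul_sum, smul_smul])
      (by
        intro u G H
        refine ContinuousMap.ext fun t => ?_
        simp only [ContinuousMap.coe_mk, ContinuousMap.add_apply]
        rw [← intervalIntegral.integral_add (ctrl_intervalIntegrable u G t)
          (ctrl_intervalIntegrable u H t)]
        simp [smul_add, Finset.sum_add_distrib])
      (by
        intro c u G
        refine ContinuousMap.ext fun t => ?_
        simp only [ContinuousMap.coe_mk, ContinuousMap.smul_apply]
        rw [← intervalIntegral.integral_smul]
        congr 1
        ext1 s
        rw [Finset.smul_sum]
        exact Finset.sum_congr rfl fun i _ => smul_comm (u s i) c (G (Set.projIcc 0 1 zero_le_one s) i)))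
    k (by
      intro u G
      rw [ContinuousMap.norm_le _ (by positivity)]
      exact fun t => ctrl_bound u G t)

lemma ctrlOp_apply {n k : ℕ} (u : LpOne k) (G : C(Set.Icc (0 : ℝ) 1, Fin k → Fin n → ℝ))
    (t : Set.Icc (0 : ℝ) 1) : ctrlOp n k u G t =
      ∫ s in (0 : ℝ)..(t : ℝ), ∑ i, u s i • G (Set.projIcc 0 1 zero_le_one s) i := rfl

lemma ctrlOp_norm_le {n k : ℕ} (u : LpOne k) : ‖ctrlOp n k u‖ ≤ k * ‖u‖ := by
  refine ContinuousLinearMap.opNorm_le_bound _ (by positivity) fun G => ?_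
  rw [ContinuousMap.norm_le _ (by positivity)]
  exact fun t => ctrl_bound u G t

/-- Constant curves. -/
def constOp (n : ℕ) : (Fin n → ℝ) →L[ℝ] C(Set.Icc (0 : ℝ) 1, Fin n → ℝ) :=
  LinearMap.mkContinuous
    { toFun := fun x => ContinuousMap.const _ x
      map_add' := by intros; ext; simp
      map_smul' := by intros; ext; simp } 1 (by
        intro x
        rw [ContinuousMap.norm_le _ (by positivity)]
        intro t; simp)

lemma constOp_apply {n : ℕ} (x : Fin n → ℝ) (t : Set.Icc (0 : ℝ) 1) : constOp n x t = x := rfl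

/-- The defect map whose zeros are the solutions. -/
def defect {n k : ℕ} (Y : (Fin n → ℝ) → (Fin k → Fin n → ℝ))
    (q : (LpOne k × (Fin n → ℝ)) × C(Set.Icc (0 : ℝ) 1, Fin n → ℝ)) :
    C(Set.Icc (0 : ℝ) 1, Fin n → ℝ) :=
  q.2 - constOp n q.1.2 - ctrlOp n k q.1.1 (nemOp (Set.Icc (0 : ℝ) 1) Y q.2)

end Control

section Main
open Topology
open scoped ContDiff

lemma solvesODE_iff {n k : ℕ} {M : Set (Fin n → ℝ)} {X : Fin k → (Fin n → ℝ) → (Fin n → ℝ)}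
    (hX : ContinuousOn (fun x i => X i x) M) (p : LpOne k × (Fin n → ℝ))
    {γ : C(Set.Icc (0 : ℝ) 1, Fin n → ℝ)} (hγ : ∀ t, γ t ∈ M) :
    SolvesODE X (⇑p.1) p.2 γ ↔ defect (fun x i => X i x) (p, γ) = 0 := by
  have key : ∀ s : ℝ, ∑ i, p.1 s i • X i (γ (Set.projIcc 0 1 zero_le_one s)) =
      ∑ i, p.1 s i • (nemOp (Set.Icc (0 : ℝ) 1) (fun x i => X i x) γ)
        (Set.projIcc 0 1 zero_le_one s) i := by
    intro s
    rw [nemOp_apply hX hγ]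
  unfold SolvesODE
  simp only [key]
  constructor
  · intro h
    refine ContinuousMap.ext fun t => ?_
    have := (h t).2
    simp only [defect, ContinuousMap.sub_apply, constOp_apply, ctrlOp_apply,
      ContinuousMap.zero_apply]
    rw [this]
    abel
  · intro h t
    refine ⟨ctrl_intervalIntegrable _ _ t, ?_⟩
    have := congrArg (fun g => g t) h
    simp only [defect, ContinuousMap.sub_apply, constOp_apply, ctrlOp_apply,
      ContinuousMap.zero_apply] at this
    rw [sub_sub, sub_eq_zero] at this
    exact this

lemma defect_unique {n k : ℕ} {M : Set (Fin n → ℝ)} {Y : (Fin n → ℝ) → (Fin k → Fin n → ℝ)}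
    (hY : ContinuousOn Y M) {C : ℝ} (hC : 0 ≤ C)
    (hL : ∀ x ∈ M, ∀ y ∈ M, ‖Y x - Y y‖ ≤ C * ‖x - y‖) {p : LpOne k × (Fin n → ℝ)}
    (hp : k * ‖p.1‖ * C < 1) {γ η : C(Set.Icc (0 : ℝ) 1, Fin n → ℝ)}
    (hγ : ∀ t, γ t ∈ M) (hη : ∀ t, η t ∈ M) (h1 : defect Y (p, γ) = 0)
    (h2 : defect Y (p, η) = 0) : γ = η := by
  have h3 : γ - η = ctrlOp n k p.1 (nemOp _ Y γ - nemOp _ Y η) := by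
    simp only [defect] at h1 h2
    rw [sub_sub, sub_eq_zero] at h1 h2
    rw [map_sub]
    nth_rewrite 1 [h1, h2]
    abel
  have h4 : ‖nemOp (Set.Icc (0 : ℝ) 1) Y γ - nemOp (Set.Icc (0 : ℝ) 1) Y η‖ ≤ C * ‖γ - η‖ := by
    rw [ContinuousMap.norm_le _ (by positivity)]
    intro t
    rw [ContinuousMap.sub_apply, nemOp_apply hY hγ, nemOp_apply hY hη]
    refine (hL _ (hγ t) _ (hη t)).trans ?_
    gcongr
    exact (γ - η).norm_coe_le_norm t
  have h5 : ‖γ - η‖ ≤ (k * ‖p.1‖ * C) * ‖γ - η‖ := by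
    calc ‖γ - η‖ = ‖ctrlOp n k p.1 (nemOp _ Y γ - nemOp _ Y η)‖ := by rw [← h3]
      _ ≤ (k * ‖p.1‖) * (C * ‖γ - η‖) :=
        (ctrlOp n k p.1).le_of_opNorm_le_of_le (ctrlOp_norm_le p.1) h4
      _ = _ := by ring
  have h6 : ‖γ - η‖ = 0 := by nlinarith [norm_nonneg (γ - η)]
  exact sub_eq_zero.1 (norm_eq_zero.1 h6)

lemma defect_contDiffAt {n k : ℕ} {M : Set (Fin n → ℝ)} (hM : IsOpen M)
    {Y : (Fin n → ℝ) → (Fin k → Fin n → ℝ)}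
    (hY : ContDiffOn ℝ ∞ Y M) {p : LpOne k × (Fin n → ℝ)}
    {γ : C(Set.Icc (0 : ℝ) 1, Fin n → ℝ)} (hγ : ∀ t, γ t ∈ M) :
    ContDiffAt ℝ ∞ (defect Y) (p, γ) := by
  have h1 : ContDiffAt ℝ ∞ (nemOp (Set.Icc (0 : ℝ) 1) Y) γ :=
    (nemOp_contDiffOn hM hY).contDiffAt ((isOpen_curves hM).mem_nhds hγ)
  have h2 : ContDiffAt ℝ ∞ (fun q : (LpOne k × (Fin n → ℝ)) ×
      C(Set.Icc (0 : ℝ) 1, Fin n → ℝ) => nemOp (Set.Icc (0 : ℝ) 1) Y q.2) (p, γ) :=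
    ContDiffAt.comp (p, γ) h1 contDiffAt_snd
  unfold defect
  refine ContDiffAt.sub (ContDiffAt.sub contDiffAt_snd ?_) ?_
  · exact (constOp n).contDiff.contDiffAt.comp (p, γ) (contDiffAt_snd.comp (p, γ) contDiffAt_fst)
  · have h0 : ContDiff ℝ ∞ (ctrlOp n k) := by fun_prop
    have h3 : ContDiffAt ℝ ∞ (fun q : (LpOne k × (Fin n → ℝ)) ×
        C(Set.Icc (0 : ℝ) 1, Fin n → ℝ) => ctrlOp n k q.1.1) (p, γ) :=
      ContDiffAt.comp (p, γ) (g := ctrlOp n k) (f := fun q : (LpOne k × (Fin n → ℝ)) ×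
        C(Set.Icc (0 : ℝ) 1, Fin n → ℝ) => q.1.1) h0.contDiffAt
        (contDiffAt_fst.comp (p, γ) contDiffAt_fst)
    exact ContDiffAt.clm_apply h3 h2

lemma defect_invertible {n k : ℕ} {M : Set (Fin n → ℝ)} (hM : IsOpen M)
    {Y : (Fin n → ℝ) → (Fin k → Fin n → ℝ)}
    (hY : ContDiffOn ℝ ∞ Y M) {C : ℝ} (hC : 0 ≤ C)
    (hL : ∀ x ∈ M, ∀ y ∈ M, ‖Y x - Y y‖ ≤ C * ‖x - y‖) {p : LpOne k × (Fin n → ℝ)}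
    (hp : k * ‖p.1‖ * C < 1)
    {γ : C(Set.Icc (0 : ℝ) 1, Fin n → ℝ)} (hγ : ∀ t, γ t ∈ M) :
    (fderiv ℝ (defect Y) (p, γ) ∘L .inr ℝ (LpOne k × (Fin n → ℝ))
      C(Set.Icc (0 : ℝ) 1, Fin n → ℝ)).IsInvertible := by
  set D := evOp (Set.Icc (0 : ℝ) 1) (Fin n → ℝ) (Fin k → Fin n → ℝ)
    (nemOp (Set.Icc (0 : ℝ) 1) (fderiv ℝ Y) γ) with hD
  have hN : HasFDerivAt (nemOp (Set.Icc (0 : ℝ) 1) Y) D γ :=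
    nemOp_hasFDerivAt hM (hY.of_le (by simp)) hγ
  set R := (ctrlOp n k p.1) ∘L D with hR
  have hd : HasFDerivAt (defect Y) (fderiv ℝ (defect Y) (p, γ)) (p, γ) :=
    ((defect_contDiffAt hM hY hγ).differentiableAt (by simp)).hasFDerivAt
  have hc := hd.comp γ (hasFDerivAt_prodMk_right p γ)
  have hc' : HasFDerivAt (defect Y ∘ fun y => (p, y)) (ContinuousLinearMap.id ℝ _ - R) γ := by
    have := ((hasFDerivAt_id γ).sub_const (constOp n p.2)).sub
      ((ctrlOp n k p.1).hasFDerivAt.comp γ hN)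
    exact this
  rw [hc.unique hc']
  have hDn : ‖D‖ ≤ C := by
    refine ContinuousLinearMap.opNorm_le_bound _ hC fun h => ?_
    rw [ContinuousMap.norm_le _ (by positivity)]
    intro t
    rw [hD, evOp_apply, nemOp_apply (hY.continuousOn_fderiv_of_isOpen hM (by simp)) hγ]
    refine ContinuousLinearMap.le_of_opNorm_le_of_le _ ?_ (h.norm_coe_le_norm t)
    refine norm_fderiv_le_of_lip' ℝ hC ?_
    filter_upwards [hM.mem_nhds (hγ t)] with x hx
    exact hL _ hx _ (hγ t)
  have hRn : ‖R‖ < 1 := by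
    refine lt_of_le_of_lt ?_ hp
    refine (ContinuousLinearMap.opNorm_comp_le _ _).trans ?_
    gcongr
    exact ctrlOp_norm_le p.1
  let U := Units.oneSub R hRn
  exact ⟨ContinuousLinearEquiv.unitsEquiv ℝ _ U, by ext1 x; rfl⟩

end Main

/-- Well-posedness and smooth dependence for the controlled ODE: there is an open set
`𝒰 ⊆ L¹([0,1];ℝ^k) × M` containing `{0} × M` on which the equation
`γ(t) = x + ∫₀ᵗ ∑ᵢ uᵢ(s)•Xᵢ(γ(s)) ds` has a unique solution `γ ∈ C([0,1]; M)`, and the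
solution map `(u,x) ↦ γ` is `C^∞` into `C([0,1];ℝⁿ)`. -/
theorem controlled_ode_wellposed_smooth {n k : ℕ} (M : Set (Fin n → ℝ)) (hMopen : IsOpen M)
    (hMconn : IsConnected M) (X : Fin k → (Fin n → ℝ) → (Fin n → ℝ))
    (hXsmooth : ∀ i, ContDiffOn ℝ (⊤ : ℕ∞) (X i) M)
    (K L : ℝ) (hK : ∀ i, ∀ x ∈ M, ‖X i x‖ ≤ K)
    (hL : ∀ i, ∀ x ∈ M, ∀ y ∈ M, ‖X i x - X i y‖ ≤ L * ‖x - y‖) :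
    ∃ 𝒰 : Set (LpOne k × (Fin n → ℝ)),
      IsOpen 𝒰 ∧ (∀ x ∈ M, ((0 : LpOne k), x) ∈ 𝒰) ∧ (∀ p ∈ 𝒰, p.2 ∈ M) ∧
      ∃ sol : LpOne k × (Fin n → ℝ) → C(Set.Icc (0 : ℝ) 1, Fin n → ℝ),
        ContDiffOn ℝ (⊤ : ℕ∞) sol 𝒰 ∧
        ∀ p ∈ 𝒰, (∀ t, sol p t ∈ M) ∧ SolvesODE X (⇑p.1) p.2 (sol p) ∧
          ∀ γ : C(Set.Icc (0 : ℝ) 1, Fin n → ℝ),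
            (∀ t, γ t ∈ M) → SolvesODE X (⇑p.1) p.2 γ → γ = sol p := by
  classical
  set Y : (Fin n → ℝ) → (Fin k → Fin n → ℝ) := fun x i => X i x with hYdef
  have hY : ContDiffOn ℝ (⊤ : ℕ∞) Y M := contDiffOn_pi.2 hXsmooth
  have hLY : ∀ x ∈ M, ∀ y ∈ M, ‖Y x - Y y‖ ≤ |L| * ‖x - y‖ := by
    intro x hx y hy
    rw [pi_norm_le_iff_of_nonneg (by positivity)]
    intro i
    refine (hL i x hx y hy).trans ?_
    gcongr
    exact le_abs_self L
  have hLn : 0 ≤ |L| := abs_nonneg L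
  let good : LpOne k × (Fin n → ℝ) → C(Set.Icc (0 : ℝ) 1, Fin n → ℝ) → Prop :=
    fun p γ => (∀ t, γ t ∈ M) ∧ defect Y (p, γ) = 0
  let 𝒰 : Set (LpOne k × (Fin n → ℝ)) := {p | k * ‖p.1‖ * |L| < 1 ∧ ∃ γ, good p γ}
  let sol : LpOne k × (Fin n → ℝ) → C(Set.Icc (0 : ℝ) 1, Fin n → ℝ) :=
    fun p => if h : ∃ γ, good p γ then h.choose else 0
  have hsol : ∀ p ∈ 𝒰, good p (sol p) := by
    intro p hp
    simp only [sol, dif_pos hp.2]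
    exact hp.2.choose_spec
  have huniq : ∀ p ∈ 𝒰, ∀ γ, good p γ → γ = sol p := fun p hp γ hγ =>
    defect_unique hY.continuousOn hLn hLY hp.1 hγ.1 (hsol p hp).1 hγ.2 (hsol p hp).2
  -- local analysis at each point of `𝒰`
  have hloc : ∀ p ∈ 𝒰, ∃ ψ : LpOne k × (Fin n → ℝ) → C(Set.Icc (0 : ℝ) 1, Fin n → ℝ),
      ContDiffAt ℝ (⊤ : ℕ∞) ψ p ∧ ∀ᶠ q in nhds p, q ∈ 𝒰 ∧ good q (ψ q) := by
    intro p hp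
    have hg := hsol p hp
    have hcd := defect_contDiffAt (p := p) hMopen hY hg.1
    have hinv := defect_invertible (p := p) hMopen hY hLn hLY hp.1 hg.1
    have hψ := hcd.contDiffAt_implicitFunction (by simp) hinv
    have hψe := hcd.eventually_apply_implicitFunction (by simp) hinv
    have hψp := hcd.implicitFunction_apply_self (by simp) hinv
    set ψ := hcd.implicitFunction (by simp) hinv
    refine ⟨ψ, hψ, ?_⟩
    have hM' : ∀ᶠ q in nhds p, ψ q ∈ {γ : C(Set.Icc (0 : ℝ) 1, Fin n → ℝ) | ∀ t, γ t ∈ M} := by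
      refine hψ.continuousAt.eventually_mem ((isOpen_curves hMopen).mem_nhds ?_)
      have : ψ p = sol p := hψp
      change ∀ t, ψ p t ∈ M
      rw [this]
      exact hg.1
    have hsmall : ∀ᶠ q : LpOne k × (Fin n → ℝ) in nhds p, k * ‖q.1‖ * |L| < 1 := by
      have hc : Continuous fun q : LpOne k × (Fin n → ℝ) => k * ‖q.1‖ * |L| := by fun_prop
      exact hc.continuousAt.eventually_lt continuousAt_const hp.1
    filter_upwards [hψe, hM', hsmall] with q h1 h2 h3
    have hgq : good q (ψ q) := ⟨h2, h1.trans hg.2⟩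
    exact ⟨⟨h3, _, hgq⟩, hgq⟩
  refine ⟨𝒰, ?_, ?_, ?_, sol, ?_, ?_⟩
  · rw [isOpen_iff_mem_nhds]
    intro p hp
    obtain ⟨ψ, -, h⟩ := hloc p hp
    exact h.mono fun q hq => hq.1
  · intro x hx
    refine ⟨by simp, constOp n x, fun t => hx, ?_⟩
    simp [defect]
  · intro p hp
    have hg := hsol p hp
    have h0 := ((solvesODE_iff hY.continuousOn p hg.1).2 hg.2 ⟨0, by simp⟩).2
    simp only [intervalIntegral.integral_same, add_zero] at h0
    rw [← h0]
    exact hg.1 _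
  · intro p hp
    obtain ⟨ψ, hψ, h⟩ := hloc p hp
    refine (hψ.congr_of_eventuallyEq ?_).contDiffWithinAt
    filter_upwards [h] with q hq
    exact (huniq q hq.1 _ hq.2).symm
  · intro p hp
    have hg := hsol p hp
    refine ⟨hg.1, (solvesODE_iff hY.continuousOn p hg.1).2 hg.2, fun γ hγ hs => ?_⟩
    exact huniq p hp γ ⟨hγ, (solvesODE_iff hY.continuousOn p hγ).1 hs⟩
end
end

section
/- Let M ⊆ ℝⁿ be open and connected and let X₁,…,X_k : M → ℝⁿ be smooth vector fields that are bounded by K, Lipschitz with constant L, and bracket generating on M. Fix x ∈ M and let End_x denote the endpoint map u ↦ γᵤ(1), defined on the open set of controls u ∈ L¹([0,1];ℝ^k) for which the equation γ'(t) = Σᵢ uᵢ(t)·Xᵢ(γ(t)), γ(0) = x has a solution γᵤ ∈ C([0,1];M). Then End_x is an open map, and there exists a control u in its domain at which the Fréchet derivative of End_x is surjective onto ℝⁿ (i.e. the maximal rank of End_x equals n). -/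
noncomputable section
open MeasureTheory

/-- The Lie bracket of two vector fields on `ℝⁿ`. -/
def lieB {n : ℕ} (X Y : (Fin n → ℝ) → (Fin n → ℝ)) : (Fin n → ℝ) → (Fin n → ℝ) :=
  fun x => fderiv ℝ Y x (X x) - fderiv ℝ X x (Y x)

/-- The smallest set of vector fields containing `V` and closed under Lie brackets. -/
inductive LieHull {n : ℕ} (V : Set ((Fin n → ℝ) → (Fin n → ℝ))) :
    ((Fin n → ℝ) → (Fin n → ℝ)) → Prop
  | base {X} : X ∈ V → LieHull V X
  | br {X Y} : LieHull V X → LieHull V Y → LieHull V (lieB X Y)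

/-- The family `V` is bracket generating on `U`. -/
def BracketGenerating {n : ℕ} (U : Set (Fin n → ℝ))
    (V : Set ((Fin n → ℝ) → (Fin n → ℝ))) : Prop :=
  ∀ x ∈ U, Submodule.span ℝ {v | ∃ Z, LieHull V Z ∧ v = Z x} = ⊤

/-! ### Primitives -/

/-- `γ` is a primitive of `g` on `[a,b]`. -/
def PrimOn {F : Type*} [NormedAddCommGroup F] [NormedSpace ℝ F] (a b : ℝ) (γ g : ℝ → F) : Prop :=
  IntervalIntegrable g volume a b ∧
    ∀ s ∈ Set.Icc a b, ∀ t ∈ Set.Icc a b, γ t - γ s = ∫ x in s..t, g x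

/-- Gluing of two functions at `b`. -/
def glueAt {F : Type*} (b : ℝ) (f g : ℝ → F) : ℝ → F := fun s => if s ≤ b then f s else g s

section PrimSec

set_option linter.unusedSectionVars false

variable {F : Type*} [NormedAddCommGroup F] [NormedSpace ℝ F]

lemma ii_sub {a b s t : ℝ} {g : ℝ → F} (hg : IntervalIntegrable g volume a b)
    (hs : s ∈ Set.Icc a b) (ht : t ∈ Set.Icc a b) : IntervalIntegrable g volume s t := by
  refine hg.mono_set ?_
  rw [Set.uIcc_of_le (hs.1.trans hs.2)]
  exact Set.uIcc_subset_Icc hs ht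

lemma PrimOn.of_left {a b : ℝ} {γ g : ℝ → F} (hg : IntervalIntegrable g volume a b)
    (h : ∀ t ∈ Set.Icc a b, γ t - γ a = ∫ x in a..t, g x) : PrimOn a b γ g := by
  refine ⟨hg, fun s hs t ht => ?_⟩
  have ha : a ∈ Set.Icc a b := ⟨le_rfl, hs.1.trans hs.2⟩
  have h1 := h s hs
  have h2 := h t ht
  have h3 := intervalIntegral.integral_add_adjacent_intervals (ii_sub hg ha hs) (ii_sub hg hs ht)
  rw [← h1, ← h2] at h3
  rw [← sub_eq_iff_eq_add'.2 h3.symm]; abel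

lemma PrimOn.continuousOn {a b : ℝ} {γ g : ℝ → F} (hab : a ≤ b) (h : PrimOn a b γ g) :
    ContinuousOn γ (Set.Icc a b) := by
  have h1 : ContinuousOn (fun t => γ a + ∫ x in a..t, g x) (Set.Icc a b) := by
    refine continuousOn_const.add ?_
    have := intervalIntegral.continuousOn_primitive_interval (a := a) (b := b) (f := g) (μ := volume)
      (by rw [Set.uIcc_of_le hab]; exact (intervalIntegrable_iff_integrableOn_Icc_of_le hab).1 h.1)
    rwa [Set.uIcc_of_le hab] at this
  refine h1.congr fun t ht => ?_
  simp only [← h.2 a ⟨le_rfl, hab⟩ t ht]; abel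

lemma PrimOn.sub {a b c d : ℝ} {γ g : ℝ → F} (h : PrimOn a b γ g)
    (hc : c ∈ Set.Icc a b) (hd : d ∈ Set.Icc a b) : PrimOn c d γ g :=
  ⟨ii_sub h.1 hc hd, fun s hs t ht => h.2 s ⟨hc.1.trans hs.1, hs.2.trans hd.2⟩ t
    ⟨hc.1.trans ht.1, ht.2.trans hd.2⟩⟩

lemma PrimOn.congr {a b : ℝ} (hab : a ≤ b) {γ g γ' g' : ℝ → F} (h : PrimOn a b γ g)
    (h1 : ∀ t ∈ Set.Icc a b, γ' t = γ t) (h2 : ∀ t ∈ Set.Ioc a b, g' t = g t) :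
    PrimOn a b γ' g' := by
  constructor
  · refine h.1.congr fun t ht => ?_
    rw [Set.uIoc_of_le hab] at ht
    exact (h2 t ht).symm
  · intro s hs t ht
    rw [h1 s hs, h1 t ht, h.2 s hs t ht]
    refine intervalIntegral.integral_congr_ae (Filter.Eventually.of_forall fun x hx => ?_)
    refine (h2 x ?_).symm
    rcases Set.mem_uIoc.1 hx with h | h
    · exact ⟨hs.1.trans_lt h.1, h.2.trans ht.2⟩
    · exact ⟨ht.1.trans_lt h.1, h.2.trans hs.2⟩

lemma PrimOn.concat {a b c : ℝ} (hab : a ≤ b) (hbc : b ≤ c) {γ g : ℝ → F} (h1 : PrimOn a b γ g)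
    (h2 : PrimOn b c γ g) : PrimOn a c γ g := by
  refine PrimOn.of_left (h1.1.trans h2.1) fun t ht => ?_
  rcases le_total t b with h | h
  · exact h1.2 a ⟨le_rfl, hab⟩ t ⟨ht.1, h⟩
  · rw [← intervalIntegral.integral_add_adjacent_intervals h1.1
      (ii_sub h2.1 ⟨le_rfl, hbc⟩ ⟨h, ht.2⟩), ← h1.2 a ⟨le_rfl, hab⟩ b ⟨hab, le_rfl⟩,
      ← h2.2 b ⟨le_rfl, hbc⟩ t ⟨h, ht.2⟩]
    abel

lemma glueAt_left {G : Type*} {b : ℝ} {f g : ℝ → G} {s : ℝ} (h : s ≤ b) :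
    glueAt b f g s = f s := if_pos h

lemma glueAt_right {G : Type*} {b : ℝ} {f g : ℝ → G} (hfg : g b = f b) {s : ℝ} (h : b ≤ s) :
    glueAt b f g s = g s := by
  unfold glueAt
  split_ifs with h1
  · rw [le_antisymm h1 h, hfg]
  · rfl

lemma PrimOn.glue {a b c : ℝ} (hab : a ≤ b) (hbc : b ≤ c) {γ g γ2 g2 : ℝ → F}
    (h1 : PrimOn a b γ g) (h2 : PrimOn b c γ2 g2) (h : γ2 b = γ b) :
    PrimOn a c (glueAt b γ γ2) (glueAt b g g2) := by
  refine PrimOn.concat hab hbc (h1.congr hab (fun t ht => glueAt_left ht.2)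
    (fun t ht => glueAt_left ht.2)) (h2.congr hbc (fun t ht => glueAt_right h ht.1)
    (fun t ht => if_neg (not_le.2 ht.1)))

lemma ii_glue {a b c : ℝ} (hab : a ≤ b) (hbc : b ≤ c) {g g2 : ℝ → F}
    (h1 : IntervalIntegrable g volume a b) (h2 : IntervalIntegrable g2 volume b c) :
    IntervalIntegrable (glueAt b g g2) volume a c ∧
    ∫ x in a..c, glueAt b g g2 x = (∫ x in a..b, g x) + ∫ x in b..c, g2 x := by
  have e1 : ∀ x ∈ Set.uIoc a b, g x = glueAt b g g2 x := fun x hx => by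
    rw [Set.uIoc_of_le hab] at hx; exact (glueAt_left hx.2).symm
  have e2 : ∀ x ∈ Set.uIoc b c, g2 x = glueAt b g g2 x := fun x hx => by
    rw [Set.uIoc_of_le hbc] at hx; exact (if_neg (not_le.2 hx.1)).symm
  have i1 := h1.congr e1
  have i2 := h2.congr e2
  refine ⟨i1.trans i2, ?_⟩
  rw [← intervalIntegral.integral_add_adjacent_intervals i1 i2]
  congr 1
  · exact intervalIntegral.integral_congr_ae (Filter.Eventually.of_forall fun x hx => (e1 x hx).symm)
  · exact intervalIntegral.integral_congr_ae (Filter.Eventually.of_forall fun x hx => (e2 x hx).symm)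

lemma ii_comp {a b a' b' m d : ℝ} (hm : m ≠ 0) {g : ℝ → F} (hg : IntervalIntegrable g volume a b)
    (h1 : m * a' + d ∈ Set.Icc a b) (h2 : m * b' + d ∈ Set.Icc a b) :
    IntervalIntegrable (fun s => g (m * s + d)) volume a' b' := by
  have h := (ii_sub hg h1 h2).comp_add_right d
  have h3 := h.comp_mul_left (c := m)
  simpa [hm] using h3

lemma PrimOn.comp {a b a' b' m d : ℝ} (hm : m ≠ 0) {γ g : ℝ → F} (h : PrimOn a b γ g)
    (hab : a' ≤ b')
    (hmaps : ∀ s ∈ Set.Icc a' b', m * s + d ∈ Set.Icc a b) :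
    PrimOn a' b' (fun s => γ (m * s + d)) (fun s => m • g (m * s + d)) := by
  constructor
  · exact (ii_comp hm h.1 (hmaps _ ⟨le_rfl, hab⟩) (hmaps _ ⟨hab, le_rfl⟩)).smul m
  · intro s hs t ht
    rw [intervalIntegral.integral_smul, intervalIntegral.smul_integral_comp_mul_add]
    exact h.2 _ (hmaps s hs) _ (hmaps t ht)

lemma PrimOn.hasDerivWithinAt [CompleteSpace F] {a b : ℝ} (hab : a ≤ b) {γ g : ℝ → F}
    (h : PrimOn a b γ g) (hg : ContinuousOn g (Set.Icc a b)) {t : ℝ} (ht : t ∈ Set.Icc a b) :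
    HasDerivWithinAt γ (g t) (Set.Icc a b) t := by
  set G : ℝ → F := Set.IccExtend hab ((Set.Icc a b).domRestrict g) with hG
  have hGc : Continuous G := (continuousOn_iff_continuous_domRestrict.1 hg).Icc_extend'
  have hGg : ∀ x ∈ Set.Icc a b, G x = g x := fun x hx => by
    rw [hG, Set.IccExtend_of_mem hab _ hx]; rfl
  have h1 : HasDerivAt (fun t => γ a + ∫ x in a..t, G x) (G t) t :=
    ((intervalIntegral.integral_hasStrictDerivAt_right (hGc.intervalIntegrable _ _)
      (hGc.stronglyMeasurableAtFilter _ _) hGc.continuousAt).hasDerivAt).const_add _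
  rw [← hGg t ht]
  refine h1.hasDerivWithinAt.congr_of_mem (fun y hy => ?_) ht
  have h2 := h.2 a ⟨le_rfl, hab⟩ y hy
  rw [sub_eq_iff_eq_add'] at h2
  rw [h2]
  congr 1
  refine intervalIntegral.integral_congr fun x hx => ?_
  rw [Set.uIcc_of_le hy.1] at hx
  exact (hGg x ⟨hx.1, hx.2.trans hy.2⟩).symm

lemma primOn_of_hasDerivAt [CompleteSpace F] {a b : ℝ} {γ g : ℝ → F}
    (h : ∀ t ∈ Set.Icc a b, HasDerivAt γ (g t) t) (hg : ContinuousOn g (Set.Icc a b))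
    (hab : a ≤ b) : PrimOn a b γ g := by
  have hi : IntervalIntegrable g volume a b := by
    refine ContinuousOn.intervalIntegrable ?_
    rwa [Set.uIcc_of_le hab]
  refine PrimOn.of_left hi fun t ht => ?_
  refine (intervalIntegral.integral_eq_sub_of_hasDerivAt (fun x hx => h x ?_) (ii_sub hi
    ⟨le_rfl, hab⟩ ht)).symm
  rw [Set.uIcc_of_le ht.1] at hx
  exact ⟨hx.1, hx.2.trans ht.2⟩

lemma primOn_const {a b : ℝ} (z : F) : PrimOn a b (fun _ => z) (fun _ => 0) :=
  ⟨by simp, fun s _ t _ => by simp⟩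

lemma PrimOn.add {a b : ℝ} {γ g γ2 g2 : ℝ → F} (h1 : PrimOn a b γ g) (h2 : PrimOn a b γ2 g2) :
    PrimOn a b (fun s => γ s + γ2 s) (fun s => g s + g2 s) := by
  refine ⟨h1.1.add h2.1, fun s hs t ht => ?_⟩
  rw [intervalIntegral.integral_add (ii_sub h1.1 hs ht) (ii_sub h2.1 hs ht), ← h1.2 s hs t ht,
    ← h2.2 s hs t ht]
  simp only []
  abel

lemma PrimOn.smul {a b : ℝ} {γ g : ℝ → F} (h1 : PrimOn a b γ g) (c : ℝ) :
    PrimOn a b (fun s => c • γ s) (fun s => c • g s) := by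
  refine ⟨h1.1.smul c, fun s hs t ht => ?_⟩
  rw [intervalIntegral.integral_smul, ← h1.2 s hs t ht, smul_sub]

end PrimSec

/-! ### Volterra operators -/

section VoltSec

open Set Filter Topology

set_option linter.unusedSectionVars false
set_option linter.unusedSimpArgs false

variable {F : Type*} [NormedAddCommGroup F] [NormedSpace ℝ F] [CompleteSpace F]

/-- The unit interval. -/
abbrev II : Type := Set.Icc (0 : ℝ) 1

/-- Projection to the unit interval. -/
def pr (s : ℝ) : II := Set.projIcc 0 1 zero_le_one s

lemma continuous_pr : Continuous pr := continuous_projIcc (h := zero_le_one)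

lemma pr_of_mem {s : ℝ} (hs : s ∈ Icc (0 : ℝ) 1) : pr s = ⟨s, hs⟩ := projIcc_of_mem _ hs

lemma pr_val (t : II) : pr (t : ℝ) = t := pr_of_mem t.2

lemma ii_of_io {g : ℝ → F} (hg : IntegrableOn g (Icc 0 1)) {s t : ℝ} (hs : s ∈ Icc (0 : ℝ) 1)
    (ht : t ∈ Icc (0 : ℝ) 1) : IntervalIntegrable g volume s t :=
  ii_sub ((intervalIntegrable_iff_integrableOn_Icc_of_le zero_le_one).2 hg) hs ht

/-- The primitive as a continuous map. -/
def primC (g : ℝ → F) (hg : IntegrableOn g (Icc 0 1)) : C(II, F) :=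
  ⟨fun t => ∫ x in (0 : ℝ)..t, g x, by
    have := intervalIntegral.continuousOn_primitive_interval (a := (0 : ℝ)) (b := 1) (f := g)
      (μ := volume) (by rw [Set.uIcc_of_le zero_le_one]; exact hg)
    rw [Set.uIcc_of_le zero_le_one] at this
    exact continuousOn_iff_continuous_domRestrict.1 this⟩

lemma io_apply {G : Type*} [NormedAddCommGroup G] [NormedSpace ℝ G] {A : ℝ → F →L[ℝ] G}
    (hA : IntegrableOn A (Icc 0 1)) (h : C(II, F)) :
    IntegrableOn (fun s => A s (h (pr s))) (Icc 0 1) := by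
  refine Integrable.mono' (hA.norm.mul_const ‖h‖) ?_ (Eventually.of_forall fun s => ?_)
  · exact (isBoundedBilinearMap_apply (𝕜 := ℝ) (E := F) (F := G)).continuous.comp_aestronglyMeasurable
      (hA.aestronglyMeasurable.prodMk (h.continuous.comp continuous_pr).aestronglyMeasurable)
  · exact (A s).le_opNorm_of_le (h.norm_coe_le_norm _)

/-- Volterra operator with integrable kernel. -/
def volt (A : ℝ → F →L[ℝ] F) (hA : IntegrableOn A (Icc 0 1)) : C(II, F) →L[ℝ] C(II, F) :=
  LinearMap.mkContinuous
    { toFun := fun h => primC (fun s => A s (h (pr s))) (io_apply hA h)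
      map_add' := fun h1 h2 => by
        ext1 t
        simp only [primC, ContinuousMap.coe_mk, ContinuousMap.add_apply, map_add]
        exact intervalIntegral.integral_add (ii_of_io (io_apply hA h1) (by simp) t.2)
          (ii_of_io (io_apply hA h2) (by simp) t.2)
      map_smul' := fun c h => by
        ext1 t
        simp only [primC, ContinuousMap.coe_mk, ContinuousMap.smul_apply, map_smul, RingHom.id_apply]
        exact intervalIntegral.integral_smul _ _ }
    (∫ x in (0 : ℝ)..1, ‖A x‖) fun h => by
      have hpos : 0 ≤ ∫ x in (0 : ℝ)..1, ‖A x‖ :=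
        intervalIntegral.integral_nonneg zero_le_one fun _ _ => norm_nonneg _
      refine (ContinuousMap.norm_le _ (mul_nonneg hpos (norm_nonneg _))).2 fun t => ?_
      simp only [primC, LinearMap.coe_mk, AddHom.coe_mk, ContinuousMap.coe_mk]
      have hi := ii_of_io hA.norm (s := 0) (t := t) (by simp) t.2
      calc ‖∫ x in (0 : ℝ)..t, A x (h (pr x))‖ ≤ ∫ x in (0 : ℝ)..t, ‖A x‖ * ‖h‖ := by
            refine intervalIntegral.norm_integral_le_of_norm_le t.2.1
              (Eventually.of_forall fun s _ => (A s).le_opNorm_of_le (h.norm_coe_le_norm _))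
              (hi.mul_const _)
        _ = (∫ x in (0 : ℝ)..t, ‖A x‖) * ‖h‖ := intervalIntegral.integral_mul_const _ _
        _ ≤ _ := by
            refine mul_le_mul_of_nonneg_right ?_ (norm_nonneg _)
            exact intervalIntegral.integral_mono_interval le_rfl t.2.1 t.2.2
              (Eventually.of_forall fun _ => norm_nonneg _) (ii_of_io hA.norm (by simp) (by simp))

lemma volt_apply (A : ℝ → F →L[ℝ] F) (hA : IntegrableOn A (Icc 0 1)) (h : C(II, F)) (t : II) :
    volt A hA h t = ∫ x in (0 : ℝ)..t, A x (h (pr x)) := rfl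

/-- Multiplication by an exponential weight. -/
def wt (c : ℝ) : C(II, F) →L[ℝ] C(II, F) :=
  LinearMap.mkContinuous
    { toFun := fun h => ⟨fun t => Real.exp (c * t) • h t, by fun_prop⟩
      map_add' := fun h1 h2 => by ext1 t; simp
      map_smul' := fun a h => by
        ext1 t
        simp only [ContinuousMap.coe_mk, ContinuousMap.smul_apply, RingHom.id_apply]
        exact smul_comm _ _ _ }
    (Real.exp |c|) fun h => by
      refine (ContinuousMap.norm_le _ (by positivity)).2 fun t => ?_
      simp only [LinearMap.coe_mk, AddHom.coe_mk, ContinuousMap.coe_mk, norm_smul, Real.norm_eq_abs,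
        Real.abs_exp]
      refine mul_le_mul ?_ (h.norm_coe_le_norm _) (norm_nonneg _) (Real.exp_nonneg _)
      refine Real.exp_le_exp.2 ((le_abs_self _).trans ?_)
      rw [abs_mul]
      refine mul_le_of_le_one_right (abs_nonneg _) ?_
      rw [abs_of_nonneg t.2.1]; exact t.2.2

lemma wt_apply (c : ℝ) (h : C(II, F)) (t : II) : wt c h t = Real.exp (c * t) • h t := rfl

lemma wt_mul (c : ℝ) : (wt c * wt (-c) : C(II, F) →L[ℝ] C(II, F)) = 1 := by
  ext h t
  simp only [mul_apply_eq_comp, wt_apply, smul_smul, one_apply_eq_self]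
  rw [← Real.exp_add]; simp

lemma exists_trunc {a : ℝ → ℝ} (ha : IntegrableOn a (Icc 0 1)) :
    ∃ C : ℝ, 0 < C ∧ ∫ x in (0 : ℝ)..1, max (a x - C) 0 < 1 / 4 := by
  have h : Tendsto (fun N : ℕ => ∫ x in Icc (0 : ℝ) 1, max (a x - N) 0) atTop
      (𝓝 (∫ x in Icc (0 : ℝ) 1, (0 : ℝ))) := by
    refine tendsto_integral_of_dominated_convergence (fun x => |a x|) (fun N => ?_) ha.norm
      (fun N => Eventually.of_forall fun x => ?_) (Eventually.of_forall fun x => ?_)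
    · exact ((ha.aestronglyMeasurable.sub aestronglyMeasurable_const).sup aestronglyMeasurable_const)
    · have hN : (0 : ℝ) ≤ N := Nat.cast_nonneg N
      rw [Real.norm_eq_abs, abs_of_nonneg (le_max_right _ _)]
      exact max_le (by linarith [le_abs_self (a x)]) (abs_nonneg _)
    · refine tendsto_const_nhds.congr' ?_
      obtain ⟨N, hN⟩ := exists_nat_ge (a x)
      filter_upwards [eventually_ge_atTop N] with m hm
      have : (N : ℝ) ≤ m := by exact_mod_cast hm
      rw [max_eq_right]; linarith
  rw [integral_zero] at h
  obtain ⟨N, hN, hN1⟩ := ((h.eventually (gt_mem_nhds (by norm_num : (0 : ℝ) < 1 / 4))).and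
    (eventually_ge_atTop 1)).exists
  refine ⟨N, by exact_mod_cast hN1, ?_⟩
  rw [intervalIntegral.integral_of_le zero_le_one, ← integral_Icc_eq_integral_Ioc]
  exact hN

lemma integral_exp_weight (l t : ℝ) (hl : 0 < l) :
    ∫ s in (0 : ℝ)..t, Real.exp (-l * t + l * s) ≤ 1 / l := by
  have h : ∀ s ∈ uIcc 0 t, HasDerivAt (fun s => Real.exp (-l * t + l * s) / l)
      (Real.exp (-l * t + l * s)) s := fun s _ => by
    have h1 : HasDerivAt (fun s => -l * t + l * s) l s := by
      simpa using ((hasDerivAt_id s).const_mul l).const_add (-l * t)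
    have := (h1.exp).div_const l
    rwa [mul_div_assoc, div_self hl.ne', mul_one] at this
  rw [intervalIntegral.integral_eq_sub_of_hasDerivAt h
    (Continuous.intervalIntegrable (by fun_prop) _ _)]
  have : Real.exp (-l * t + l * t) = 1 := by simp
  rw [this]
  have : 0 ≤ Real.exp (-l * t + l * 0) / l := by positivity
  linarith

lemma isUnit_one_sub_volt (A : ℝ → F →L[ℝ] F) (hA : IntegrableOn A (Icc 0 1)) :
    IsUnit (1 - volt A hA) := by
  obtain ⟨C, hC, hCi⟩ := exists_trunc hA.norm
  set l : ℝ := 4 * C with hl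
  have hl0 : 0 < l := by positivity
  set W : (C(II, F) →L[ℝ] C(II, F))ˣ :=
    ⟨wt l, wt (-l), wt_mul l, by simpa using wt_mul (F := F) (-l)⟩ with hW
  have hnorm : ‖wt (-l) * volt A hA * wt l‖ < 1 := by
    refine lt_of_le_of_lt (b := (1 / 2 : ℝ)) ?_ (by norm_num)
    refine ContinuousLinearMap.opNorm_le_bound _ (by norm_num) fun h => ?_
    refine (ContinuousMap.norm_le _ (by positivity)).2 fun t => ?_
    simp only [mul_apply_eq_comp, wt_apply, volt_apply, map_smul]
    rw [← intervalIntegral.integral_smul]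
    have hi := ii_of_io hA.norm (s := 0) (t := t) (by simp) t.2
    have him : IntegrableOn (fun x => max (‖A x‖ - C) 0) (Icc 0 1) :=
      (hA.norm.sub (integrable_const C)).pos_part
    have hie : IntervalIntegrable (fun x => Real.exp (-l * t + l * x)) volume 0 t :=
      Continuous.intervalIntegrable (by fun_prop) _ _
    have him' := ii_of_io him (s := 0) (t := t) (by simp) t.2
    calc ‖∫ x in (0 : ℝ)..t, Real.exp (-l * t) • Real.exp (l * (pr x : ℝ)) • A x (h (pr x))‖
        ≤ ∫ x in (0 : ℝ)..t, (max (‖A x‖ - C) 0 + C * Real.exp (-l * t + l * x)) * ‖h‖ := by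
          refine intervalIntegral.norm_integral_le_of_norm_le t.2.1
              (Eventually.of_forall fun s hs => ?_)
              ((him'.add (hie.const_mul C)).mul_const _)
          have hs1 : s ∈ Icc (0 : ℝ) 1 := ⟨hs.1.le, hs.2.trans t.2.2⟩
          rw [pr_of_mem hs1, smul_smul, ← Real.exp_add, norm_smul, Real.norm_eq_abs, Real.abs_exp]
          have h1 := (A s).le_opNorm_of_le (h.norm_coe_le_norm ⟨s, hs1⟩)
          set e := Real.exp (-l * t + l * s) with he
          have he0 : 0 ≤ e := Real.exp_nonneg _
          have he1 : e ≤ 1 := by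
            rw [he]; refine Real.exp_le_one_iff.2 ?_
            have : l * s ≤ l * t := mul_le_mul_of_nonneg_left hs.2 hl0.le
            linarith
          refine (mul_le_mul_of_nonneg_left h1 he0).trans ?_
          rw [← mul_assoc]
          refine mul_le_mul_of_nonneg_right ?_ (norm_nonneg _)
          have h2 := le_max_left (‖A s‖ - C) 0
          have h3 := le_max_right (‖A s‖ - C) 0
          nlinarith [mul_le_mul_of_nonneg_right he1 h3]
      _ = ((∫ x in (0 : ℝ)..t, max (‖A x‖ - C) 0) +
            C * ∫ x in (0 : ℝ)..t, Real.exp (-l * t + l * x)) * ‖h‖ := by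
          rw [intervalIntegral.integral_mul_const, intervalIntegral.integral_add him'
            (hie.const_mul C), intervalIntegral.integral_const_mul]
      _ ≤ (1 / 4 + C * (1 / l)) * ‖h‖ := by
          refine mul_le_mul_of_nonneg_right (add_le_add ?_ ?_) (norm_nonneg _)
          · refine (intervalIntegral.integral_mono_interval le_rfl t.2.1 t.2.2
              (Eventually.of_forall fun _ => le_max_right _ _)
              (ii_of_io him (by simp) (by simp))).trans hCi.le
          · exact mul_le_mul_of_nonneg_left (integral_exp_weight l t hl0) hC.le
      _ = 1 / 2 * ‖h‖ := by rw [hl]; field_simp; ring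
  have h1 : IsUnit (1 - wt (-l) * volt A hA * wt l) :=
    isUnit_one_sub_of_norm_lt_one (R := C(II, F) →L[ℝ] C(II, F)) hnorm
  have h2 : 1 - volt A hA = (W : C(II, F) →L[ℝ] C(II, F)) * (1 - wt (-l) * volt A hA * wt l) *
      ((W⁻¹ : Units _) : C(II, F) →L[ℝ] C(II, F)) := by
    have e1 : (wt l * wt (-l) : C(II, F) →L[ℝ] C(II, F)) = 1 := wt_mul l
    have : (W : C(II, F) →L[ℝ] C(II, F)) = wt l := rfl
    have h' : ((W⁻¹ : Units _) : C(II, F) →L[ℝ] C(II, F)) = wt (-l) := rfl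
    rw [this, h', mul_sub, sub_mul, mul_one, e1]
    congr 1
    calc volt A hA = (wt l * wt (-l)) * volt A hA * (wt l * wt (-l)) := by simp [e1]
      _ = _ := by simp only [mul_assoc]
  rw [h2]
  exact (W.isUnit.mul h1).mul (W⁻¹).isUnit

lemma bijective_one_sub_volt (A : ℝ → F →L[ℝ] F) (hA : IntegrableOn A (Icc 0 1)) :
    Function.Bijective (1 - volt A hA : C(II, F) →L[ℝ] C(II, F)) :=
  ContinuousLinearMap.isUnit_iff_bijective.1 (isUnit_one_sub_volt A hA)

lemma lin_solve_unit (A : ℝ → F →L[ℝ] F) (hA : IntegrableOn A (Icc 0 1)) (z : F) :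
    ∃ h : ℝ → F, h 0 = z ∧ PrimOn 0 1 h (fun s => A s (h s)) := by
  obtain ⟨h, hh⟩ := (bijective_one_sub_volt A hA).2 (ContinuousMap.const _ z)
  have key : ∀ t : II, h t = z + ∫ x in (0 : ℝ)..t, A x (h (pr x)) := fun t => by
    have := congrArg (fun f : C(II, F) => f t) hh
    simp only [sub_apply, one_apply_eq_self,
      ContinuousMap.sub_apply, volt_apply, ContinuousMap.const_apply] at this
    rw [← this]; abel
  have h0 : h (pr 0) = z := by
    rw [pr_of_mem (by simp), key]; simp
  refine ⟨fun s => h (pr s), h0, PrimOn.of_left ?_ fun t ht => ?_⟩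
  · exact ii_of_io (io_apply hA h) (by simp) (by simp)
  · simp only [h0]
    rw [pr_of_mem ht, key]; simp

/-- Linear equations with integrable coefficients can be solved on `[a,b]` with prescribed
initial value. -/
lemma lin_solve_left {a b : ℝ} (hab : a < b) (A : ℝ → F →L[ℝ] F)
    (hA : IntervalIntegrable A volume a b) (z : F) :
    ∃ h : ℝ → F, h a = z ∧ PrimOn a b h (fun s => A s (h s)) := by
  have hba : 0 < b - a := sub_pos.2 hab
  have hA' : IntegrableOn (fun s => (b - a) • A ((b - a) * s + a)) (Icc 0 1) := by
    refine (intervalIntegrable_iff_integrableOn_Icc_of_le (μ := volume)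
      (f := fun s => (b - a) • A ((b - a) * s + a)) zero_le_one).1 ?_
    exact (ii_comp hba.ne' hA (by simp [hab.le]) (by simp [hab.le])).smul (b - a)
  obtain ⟨h, h0, hh⟩ := lin_solve_unit _ hA' z
  refine ⟨fun s => h ((b - a)⁻¹ * s + (-(b - a)⁻¹ * a)), by simpa using h0, ?_⟩
  have h2 := hh.comp (a' := a) (b' := b) (m := (b - a)⁻¹) (d := -(b - a)⁻¹ * a) (by positivity)
    hab.le (fun s hs => by
      have : (b - a)⁻¹ * s + -(b - a)⁻¹ * a = (s - a) / (b - a) := by field_simp; ring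
      rw [this]
      exact ⟨div_nonneg (by linarith [hs.1]) hba.le, (div_le_one hba).2 (by linarith [hs.2])⟩)
  refine h2.congr hab.le (fun _ _ => rfl) fun t _ => ?_
  have e : (b - a) * ((b - a)⁻¹ * t + -(b - a)⁻¹ * a) + a = t := by field_simp; ring
  simp only [e, smul_apply, smul_smul]
  rw [inv_mul_cancel₀ hba.ne', one_smul]

/-- Linear equations with integrable coefficients can be solved on `[a,b]` with prescribed
final value. -/
lemma lin_solve_right {a b : ℝ} (hab : a < b) (A : ℝ → F →L[ℝ] F)
    (hA : IntervalIntegrable A volume a b) (z : F) :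
    ∃ h : ℝ → F, h b = z ∧ PrimOn a b h (fun s => A s (h s)) := by
  have hA' : IntervalIntegrable (fun s => (-1 : ℝ) • A ((-1) * s + (a + b))) volume a b :=
    (ii_comp (m := -1) (d := a + b) (a' := a) (b' := b) (by norm_num) hA (by constructor <;> linarith) (by constructor <;> linarith)).smul (-1 : ℝ)
  obtain ⟨h, h0, hh⟩ := lin_solve_left hab _ hA' z
  refine ⟨fun s => h ((-1) * s + (a + b)), by simpa using h0, ?_⟩
  have h2 := hh.comp (a' := a) (b' := b) (m := -1) (d := a + b) (by norm_num)
    hab.le (fun s hs => by constructor <;> linarith [hs.1, hs.2])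
  refine h2.congr hab.le (fun _ _ => rfl) fun t _ => ?_
  have e : (-1) * ((-1) * t + (a + b)) + (a + b) = t := by ring
  simp only [e, smul_apply, smul_smul]
  norm_num

end VoltSec

/-! ### Trajectories and their variations -/

section TrajSec

open Set Filter Topology

set_option linter.unusedSectionVars false
set_option linter.unusedSimpArgs false

variable {n k : ℕ}

/-- `γ` is a trajectory on `[a,b]` in `M` with control `u`. -/
def Traj (M : Set (Fin n → ℝ)) (X : Fin k → (Fin n → ℝ) → (Fin n → ℝ)) (a b : ℝ)
    (u : ℝ → Fin k → ℝ) (γ : ℝ → Fin n → ℝ) : Prop :=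
  IntervalIntegrable u volume a b ∧ (∀ t ∈ Icc a b, γ t ∈ M) ∧
    PrimOn a b γ (fun s => ∑ i, u s i • X i (γ s))

/-- `h` solves the linearised equation along `γ` with variation of control `v`. -/
def Vari (X : Fin k → (Fin n → ℝ) → (Fin n → ℝ)) (a b : ℝ)
    (u : ℝ → Fin k → ℝ) (γ : ℝ → Fin n → ℝ) (v : ℝ → Fin k → ℝ) (h : ℝ → Fin n → ℝ) : Prop :=
  IntervalIntegrable v volume a b ∧
    PrimOn a b h (fun s => (∑ i, v s i • X i (γ s)) + ∑ i, u s i • fderiv ℝ (X i) (γ s) (h s))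

/-- Smoothness on `M`. -/
def Sm (M : Set (Fin n → ℝ)) (Z : (Fin n → ℝ) → (Fin n → ℝ)) : Prop :=
  ∀ x ∈ M, ContDiffAt ℝ ((⊤ : ℕ∞) : WithTop ℕ∞) Z x

variable {M : Set (Fin n → ℝ)} {X : Fin k → (Fin n → ℝ) → (Fin n → ℝ)}

lemma Sm.continuousAt {Z : (Fin n → ℝ) → (Fin n → ℝ)} (h : Sm M Z) {x} (hx : x ∈ M) :
    ContinuousAt Z x := (h x hx).continuousAt

lemma Sm.hasFDerivAt {Z : (Fin n → ℝ) → (Fin n → ℝ)} (h : Sm M Z) {x} (hx : x ∈ M) :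
    HasFDerivAt Z (fderiv ℝ Z x) x :=
  ((h x hx).differentiableAt (by simp)).hasFDerivAt

lemma Sm.continuousAt_fderiv {Z : (Fin n → ℝ) → (Fin n → ℝ)} (h : Sm M Z) {x} (hx : x ∈ M) :
    ContinuousAt (fderiv ℝ Z) x :=
  ((h x hx).fderiv_right (m := 0) (by norm_num)).continuousAt

lemma Sm.lieB {Y Z : (Fin n → ℝ) → (Fin n → ℝ)} (hY : Sm M Y) (hZ : Sm M Z) :
    Sm M (lieB Y Z) := fun x hx =>
  ContDiffAt.lieBracket_vectorField (hY x hx) (hZ x hx) (by norm_num)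

lemma Traj.continuousOn {a b : ℝ} (hab : a ≤ b) {u : ℝ → Fin k → ℝ} {γ : ℝ → Fin n → ℝ}
    (h : Traj M X a b u γ) : ContinuousOn γ (Icc a b) := h.2.2.continuousOn hab

lemma glue_traj {a b c : ℝ} (hab : a ≤ b) (hbc : b ≤ c) {u u2 : ℝ → Fin k → ℝ}
    {γ γ2 : ℝ → Fin n → ℝ} (h1 : Traj M X a b u γ) (h2 : Traj M X b c u2 γ2) (h : γ2 b = γ b) :
    Traj M X a c (glueAt b u u2) (glueAt b γ γ2) := by
  refine ⟨(ii_glue hab hbc h1.1 h2.1).1, fun t ht => ?_, ?_⟩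
  · rcases le_total t b with h' | h'
    · rw [glueAt_left h']; exact h1.2.1 t ⟨ht.1, h'⟩
    · rw [glueAt_right h h']; exact h2.2.1 t ⟨h', ht.2⟩
  · have := h1.2.2.glue hab hbc h2.2.2 h
    convert this using 1
    funext s
    unfold glueAt
    split_ifs <;> rfl

lemma glue_vari {a b c : ℝ} (hab : a ≤ b) (hbc : b ≤ c) {u u2 v v2 : ℝ → Fin k → ℝ}
    {γ γ2 h h2 : ℝ → Fin n → ℝ} (h1 : Vari X a b u γ v h) (h2v : Vari X b c u2 γ2 v2 h2)
    (hh : h2 b = h b) :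
    Vari X a c (glueAt b u u2) (glueAt b γ γ2) (glueAt b v v2) (glueAt b h h2) := by
  refine ⟨(ii_glue hab hbc h1.1 h2v.1).1, ?_⟩
  have := h1.2.glue hab hbc h2v.2 hh
  convert this using 1
  funext s
  unfold glueAt
  split_ifs <;> rfl

lemma glue_cost {a b c : ℝ} (hab : a ≤ b) (hbc : b ≤ c) {u u2 : ℝ → Fin k → ℝ}
    (h1 : IntervalIntegrable u volume a b) (h2 : IntervalIntegrable u2 volume b c) :
    ∫ s in a..c, ‖glueAt b u u2 s‖ = (∫ s in a..b, ‖u s‖) + ∫ s in b..c, ‖u2 s‖ := by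
  rw [← (ii_glue hab hbc h1.norm h2.norm).2]
  congr 1
  funext s
  unfold glueAt
  split_ifs <;> rfl

lemma Vari.add {a b : ℝ} {u v v2 : ℝ → Fin k → ℝ} {γ h h2 : ℝ → Fin n → ℝ}
    (h1 : Vari X a b u γ v h) (h2' : Vari X a b u γ v2 h2) :
    Vari X a b u γ (fun s => v s + v2 s) (fun s => h s + h2 s) := by
  refine ⟨h1.1.add h2'.1, ?_⟩
  convert h1.2.add h2'.2 using 1
  funext s
  simp only [Pi.add_apply, add_smul, map_add, smul_add, Finset.sum_add_distrib]
  abel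

lemma Vari.smul {a b : ℝ} {u v : ℝ → Fin k → ℝ} {γ h : ℝ → Fin n → ℝ}
    (h1 : Vari X a b u γ v h) (c : ℝ) :
    Vari X a b u γ (fun s => c • v s) (fun s => c • h s) := by
  refine ⟨h1.1.smul c, ?_⟩
  convert h1.2.smul c using 1
  funext s
  simp only [Pi.smul_apply, smul_eq_mul, mul_smul, map_smul, smul_add, Finset.smul_sum]
  congr 1
  exact Finset.sum_congr rfl fun i _ => smul_comm _ _ _

lemma vari_zero (a b : ℝ) (u : ℝ → Fin k → ℝ) (γ : ℝ → Fin n → ℝ) :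
    Vari X a b u γ (fun _ => 0) (fun _ => 0) := by
  refine ⟨by simp, ?_⟩
  convert primOn_const (a := a) (b := b) (0 : Fin n → ℝ) using 1
  funext s; simp

/-- Reparametrised trajectory. -/
lemma Traj.comp {a b a' b' m d : ℝ} (hm : m ≠ 0) {u : ℝ → Fin k → ℝ} {γ : ℝ → Fin n → ℝ}
    (h : Traj M X a b u γ) (hab : a' ≤ b')
    (hmaps : ∀ s ∈ Icc a' b', m * s + d ∈ Icc a b) :
    Traj M X a' b' (fun s => m • u (m * s + d)) (fun s => γ (m * s + d)) := by
  refine ⟨(ii_comp hm h.1 (hmaps _ ⟨le_rfl, hab⟩) (hmaps _ ⟨hab, le_rfl⟩)).smul m,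
    fun t ht => h.2.1 _ (hmaps t ht), ?_⟩
  convert h.2.2.comp hm hab hmaps using 1
  funext s
  simp only [Pi.smul_apply, smul_eq_mul, mul_smul, Finset.smul_sum]

lemma Traj.const {a b : ℝ} {p : Fin n → ℝ} (hp : p ∈ M) :
    Traj M X a b (fun _ => 0) (fun _ => p) := by
  refine ⟨by simp, fun _ _ => hp, ?_⟩
  convert primOn_const (a := a) (b := b) p using 1
  funext s; simp

lemma Traj.coeff {a b : ℝ} (hab : a ≤ b) (hX : ∀ i, Sm M (X i)) {u : ℝ → Fin k → ℝ}
    {γ : ℝ → Fin n → ℝ} (h : Traj M X a b u γ) :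
    IntervalIntegrable (fun s => ∑ i, u s i • fderiv ℝ (X i) (γ s)) volume a b := by
  have hi : ∀ i, IntervalIntegrable (fun s => u s i • fderiv ℝ (X i) (γ s)) volume a b := by
    intro i
    refine IntervalIntegrable.smul_continuousOn (f := fun s => u s i) ?_ ?_
    · have h1 := h.1
      rw [intervalIntegrable_iff] at h1 ⊢
      exact h1.eval i
    · rw [Set.uIcc_of_le hab]
      intro t ht
      exact ((hX i).continuousAt_fderiv (h.2.1 t ht)).comp_continuousWithinAt
        (h.continuousOn hab t ht)
  have := IntervalIntegrable.sum (μ := volume) (a := a) (b := b) Finset.univ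
    (f := fun i s => u s i • fderiv ℝ (X i) (γ s)) (fun i _ => hi i)
  have e : (fun s => ∑ i, u s i • fderiv ℝ (X i) (γ s)) =
      ∑ i, fun s => u s i • fderiv ℝ (X i) (γ s) := by funext s; simp
  rw [e]
  exact this

/-- Transport of vectors along a trajectory, with prescribed value at the end. -/
lemma Traj.transport {a b : ℝ} (hab : a < b) (hX : ∀ i, Sm M (X i)) {u : ℝ → Fin k → ℝ}
    {γ : ℝ → Fin n → ℝ} (h : Traj M X a b u γ) (z : Fin n → ℝ) :
    ∃ w, Vari X a b u γ (fun _ => 0) w ∧ w b = z := by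
  obtain ⟨w, hw, h2⟩ := lin_solve_right hab _ (h.coeff hab.le hX) z
  refine ⟨w, ⟨by simp, ?_⟩, hw⟩
  convert h2 using 1
  funext s
  simp [sum_apply]

/-- Vectors reachable by the linearised system. -/
def reach (X : Fin k → (Fin n → ℝ) → (Fin n → ℝ)) (a b : ℝ)
    (u : ℝ → Fin k → ℝ) (γ : ℝ → Fin n → ℝ) : Submodule ℝ (Fin n → ℝ) where
  carrier := {z | ∃ v h, Vari X a b u γ v h ∧ h a = 0 ∧ h b = z}
  zero_mem' := ⟨_, _, vari_zero a b u γ, rfl, rfl⟩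
  add_mem' := by
    rintro z1 z2 ⟨v1, h1, hv1, h10, h11⟩ ⟨v2, h2, hv2, h20, h21⟩
    exact ⟨_, _, hv1.add hv2, by simp [h10, h20], by simp [h11, h21]⟩
  smul_mem' := by
    rintro c z ⟨v1, h1, hv1, h10, h11⟩
    exact ⟨_, _, hv1.smul c, by simp [h10], by simp [h11]⟩

/-- Admissible data for the maximal rank argument. -/
def GoodT (M : Set (Fin n → ℝ)) (X : Fin k → (Fin n → ℝ) → (Fin n → ℝ)) (a b δ : ℝ)
    (p : Fin n → ℝ) (t : ℝ) (u : ℝ → Fin k → ℝ) (γ : ℝ → Fin n → ℝ) : Prop :=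
  a ≤ t ∧ t < b ∧ Traj M X a t u γ ∧ γ a = p ∧ ∫ s in a..t, ‖u s‖ < δ

/-- zero-control extension. -/
lemma reach_zero_ext {a t c : ℝ} (hat : a ≤ t) (htc : t < c) (u : ℝ → Fin k → ℝ)
    (γ : ℝ → Fin n → ℝ) :
    reach X a t u γ ≤ reach X a c (glueAt t u (fun _ => 0)) (glueAt t γ (fun _ => γ t)) ∧
    ∀ i, X i (γ t) ∈ reach X a c (glueAt t u (fun _ => 0)) (glueAt t γ (fun _ => γ t)) := by
  constructor
  · rintro z ⟨v, h, hv, h0, h1⟩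
    have hv2 : Vari X t c (fun _ => 0) (fun _ => γ t) (fun _ => 0) (fun _ => h t) := by
      refine ⟨by simp, ?_⟩
      convert primOn_const (a := t) (b := c) (h t) using 1
      funext s; simp
    refine ⟨_, _, glue_vari hat htc.le hv hv2 rfl, by rw [glueAt_left hat, h0], ?_⟩
    exact (glueAt_right (f := h) (g := fun _ => h t) rfl htc.le).trans h1
  · intro i
    have hv2 : Vari X t c (fun _ => 0) (fun _ => γ t) (fun _ => Pi.single i (c - t)⁻¹)
        (fun s => ((c - t)⁻¹ * (s - t)) • X i (γ t)) := by
      refine ⟨intervalIntegrable_const, ?_⟩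
      have := primOn_of_hasDerivAt (a := t) (b := c)
        (γ := fun s => ((c - t)⁻¹ * (s - t)) • X i (γ t)) (g := fun _ => (c - t)⁻¹ • X i (γ t))
        (fun s _ => by
          have h1 : HasDerivAt (fun s : ℝ => (c - t)⁻¹ * (s - t)) (c - t)⁻¹ s := by
            simpa using ((hasDerivAt_id s).sub_const t).const_mul (c - t)⁻¹
          exact h1.smul_const _) continuousOn_const htc.le
      convert this using 1
      funext s
      simp [Pi.single_apply, Finset.sum_ite_eq', ite_smul]
    refine ⟨_, _, glue_vari hat htc.le (vari_zero a t u γ) hv2 (by simp), by rw [glueAt_left hat],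
      ?_⟩
    rw [glueAt_right (by simp) htc.le, inv_mul_cancel₀ (sub_pos.2 htc).ne', one_smul]

lemma good_zero_ext {a b δ t c : ℝ} {p : Fin n → ℝ} (htc : t < c) (hcb : c < b)
    {u : ℝ → Fin k → ℝ} {γ : ℝ → Fin n → ℝ} (h : GoodT M X a b δ p t u γ) :
    GoodT M X a b δ p c (glueAt t u (fun _ => 0)) (glueAt t γ (fun _ => γ t)) := by
  obtain ⟨h1, h2, h3, h4, h5⟩ := h
  refine ⟨h1.trans htc.le, hcb, glue_traj h1 htc.le h3 (Traj.const (h3.2.1 t ⟨h1, le_rfl⟩)) rfl,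
    by rw [glueAt_left h1, h4], ?_⟩
  rw [glue_cost h1 htc.le h3.1 (by simp)]
  simpa using h5

end TrajSec

section FlowSec

open Set Filter Topology

set_option linter.unusedSectionVars false
set_option linter.unusedSimpArgs false

variable {n k : ℕ} {M : Set (Fin n → ℝ)} {X : Fin k → (Fin n → ℝ) → (Fin n → ℝ)}

lemma exists_curve (hM : IsOpen M) {Y : (Fin n → ℝ) → (Fin n → ℝ)} (hY : Sm M Y) {p : Fin n → ℝ}
    (hp : p ∈ M) (t : ℝ) {η : ℝ} (hη : 0 < η) :
    ∃ ε, 0 < ε ∧ ε < η ∧ ∃ c : ℝ → Fin n → ℝ, c t = p ∧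
      ∀ s ∈ Icc t (t + ε), c s ∈ M ∧ HasDerivAt c (Y (c s)) s := by
  obtain ⟨c, hc, e, he, h⟩ := ((hY p hp).of_le (by
    exact_mod_cast le_top) : ContDiffAt ℝ 1 Y p).exists_forall_mem_closedBall_exists_eq_forall_mem_Ioo_hasDerivAt₀ t
  have hcont : ContinuousAt c t := (h t ⟨by linarith, by linarith⟩).continuousAt
  have : ∀ᶠ s in 𝓝 t, c s ∈ M := hcont.eventually_mem (by rw [hc]; exact hM.mem_nhds hp)
  obtain ⟨r, hr, hr2⟩ := Metric.eventually_nhds_iff.1 this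
  refine ⟨min (min (e / 2) (r / 2)) (η / 2), by positivity, ?_, c, hc, fun s hs => ?_⟩
  · exact (min_le_right _ _).trans_lt (by linarith)
  · have h1 : min (min (e / 2) (r / 2)) (η / 2) ≤ e / 2 := (min_le_left _ _).trans (min_le_left _ _)
    have h2 : min (min (e / 2) (r / 2)) (η / 2) ≤ r / 2 := (min_le_left _ _).trans (min_le_right _ _)
    refine ⟨hr2 ?_, h s ⟨by linarith [hs.1], by linarith [hs.2]⟩⟩
    rw [Real.dist_eq, abs_of_nonneg (by linarith [hs.1])]
    linarith [hs.2]

lemma exists_JK {t ε : ℝ} (hε : 0 < ε) {B : ℝ → (Fin n → ℝ) →L[ℝ] (Fin n → ℝ)}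
    (hB : ContinuousOn B (Icc t (t + ε))) :
    ∃ J K : ℝ → (Fin n → ℝ) →L[ℝ] (Fin n → ℝ), J t = 1 ∧ K t = 1 ∧
      (∀ s ∈ Icc t (t + ε), K s * J s = 1) ∧
      (∀ z, PrimOn t (t + ε) (fun s => J s z) (fun s => B s (J s z))) ∧
      HasDerivWithinAt K (-(B t)) (Icc t (t + ε)) t := by
  have ht : t < t + ε := by linarith
  let L := ContinuousLinearMap.mul ℝ ((Fin n → ℝ) →L[ℝ] (Fin n → ℝ))
  have hA1 : ContinuousOn (fun s => L (B s)) (Icc t (t + ε)) := L.continuous.comp_continuousOn hB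
  have hA2 : ContinuousOn (fun s => L.flip (-(B s))) (Icc t (t + ε)) :=
    L.flip.continuous.comp_continuousOn hB.neg
  obtain ⟨J, hJ0, hJ⟩ := lin_solve_left (F := (Fin n → ℝ) →L[ℝ] (Fin n → ℝ)) ht
    (fun s => L (B s)) (ContinuousOn.intervalIntegrable (by rwa [Set.uIcc_of_le ht.le])) 1
  obtain ⟨K, hK0, hK⟩ := lin_solve_left (F := (Fin n → ℝ) →L[ℝ] (Fin n → ℝ)) ht
    (fun s => L.flip (-(B s))) (ContinuousOn.intervalIntegrable (by rwa [Set.uIcc_of_le ht.le])) 1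
  have hJc := hJ.continuousOn ht.le
  have hKc := hK.continuousOn ht.le
  have hJd : ∀ s ∈ Icc t (t + ε), HasDerivWithinAt J (B s * J s) (Icc t (t + ε)) s := fun s hs =>
    hJ.hasDerivWithinAt ht.le (hA1.clm_apply hJc) hs
  have hKd : ∀ s ∈ Icc t (t + ε), HasDerivWithinAt K (K s * -(B s)) (Icc t (t + ε)) s :=
    fun s hs => hK.hasDerivWithinAt ht.le (hA2.clm_apply hKc) hs
  refine ⟨J, K, hJ0, hK0, fun s hs => ?_, fun z => ?_, ?_⟩
  · have hd : ∀ s ∈ Icc t (t + ε), HasDerivWithinAt (fun s => K s * J s) 0 (Icc t (t + ε)) s :=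
      fun s hs => by
        have := (hKd s hs).mul (hJd s hs)
        have e : K s * -B s * J s + K s * (B s * J s) = 0 := by
          ext1 z
          change K s (-(B s (J s z))) + K s (B s (J s z)) = 0
          rw [map_neg, neg_add_cancel]
        rw [e] at this
        exact this
    have := constant_of_derivWithin_zero (fun s hs => (hd s hs).differentiableWithinAt)
      (fun s hs => (hd s ⟨hs.1, hs.2.le⟩).derivWithin (uniqueDiffOn_Icc ht s ⟨hs.1, hs.2.le⟩)) s hs
    rw [this, hJ0, hK0, one_mul]
  · have hii : ∀ s ∈ Icc t (t + ε), ∀ r ∈ Icc t (t + ε), IntervalIntegrable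
        (fun s => L (B s) (J s)) volume s r := fun s hs r hr => ii_sub hJ.1 hs hr
    refine ⟨?_, fun s hs r hr => ?_⟩
    · refine ContinuousOn.intervalIntegrable ?_
      rw [Set.uIcc_of_le ht.le]
      exact hB.clm_apply (hJc.clm_apply continuousOn_const)
    · have := hJ.2 s hs r hr
      have h2 := congrArg (fun T => ContinuousLinearMap.apply ℝ (Fin n → ℝ) z T) this
      simp only [] at h2
      rw [← ContinuousLinearMap.intervalIntegral_comp_comm _ (hii s hs r hr)] at h2
      exact h2
  · have := hKd t ⟨le_rfl, ht.le⟩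
    rwa [hK0, one_mul] at this

/-- The key step: derivative along the flow of `X i`. -/
lemma step_bracket (hM : IsOpen M) (hX : ∀ i, Sm M (X i)) {a b δ t : ℝ} {p : Fin n → ℝ}
    {u : ℝ → Fin k → ℝ} {γ : ℝ → Fin n → ℝ} (hg : GoodT M X a b δ p t u γ) (i : Fin k)
    (hmax : ∀ t' u' γ', GoodT M X a b δ p t' u' γ' →
      Module.finrank ℝ (reach X a t' u' γ') ≤ Module.finrank ℝ (reach X a t u γ))
    {Z : (Fin n → ℝ) → (Fin n → ℝ)} (hZ : Sm M Z)
    (hPZ : ∀ t' u' γ', GoodT M X a b δ p t' u' γ' →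
      Module.finrank ℝ (reach X a t' u' γ') = Module.finrank ℝ (reach X a t u γ) →
      Z (γ' t') ∈ reach X a t' u' γ') :
    lieB (X i) Z (γ t) ∈ reach X a t u γ := by
  have hpt : γ t ∈ M := hg.2.2.1.2.1 t ⟨hg.1, le_rfl⟩
  obtain ⟨ε, hε, hεη, c, hc, hcM⟩ := exists_curve hM (hX i) hpt t
    (η := min (b - t) (δ - ∫ s in a..t, ‖u s‖))
    (lt_min (sub_pos.2 hg.2.1) (sub_pos.2 hg.2.2.2.2))
  have htε : t < t + ε := by linarith
  have hcc : ContinuousOn c (Icc t (t + ε)) := fun s hs =>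
    (hcM s hs).2.continuousAt.continuousWithinAt
  have hB : ContinuousOn (fun s => fderiv ℝ (X i) (c s)) (Icc t (t + ε)) := fun s hs =>
    ((hX i).continuousAt_fderiv (hcM s hs).1).comp_continuousWithinAt (hcc s hs)
  obtain ⟨J, K, hJ0, hK0, hKJ, hJ, hK⟩ := exists_JK hε hB
  have hprim : PrimOn t (t + ε) c (fun s => X i (c s)) :=
    primOn_of_hasDerivAt (fun s hs => (hcM s hs).2)
      (fun s hs => ((hX i).continuousAt (hcM s hs).1).comp_continuousWithinAt (hcc s hs)) htε.le
  have hsum : ∀ (Y : Fin k → Fin n → ℝ), ∑ j, (Pi.single i (1 : ℝ) : Fin k → ℝ) j • Y j = Y i := by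
    intro Y; simp [Pi.single_apply, ite_smul]
  have key : ∀ s ∈ Icc t (t + ε), K s (Z (c s)) ∈ reach X a t u γ := by
    intro s hs
    rcases hs.1.eq_or_lt with h | hts
    · subst h
      rw [hK0, hc]
      exact hPZ t u γ hg rfl
    have hsub : ∀ {c' g' : ℝ → Fin n → ℝ}, PrimOn t (t + ε) c' g' → PrimOn t s c' g' := fun h =>
      h.sub ⟨le_rfl, htε.le⟩ hs
    have htr : Traj M X t s (fun _ => Pi.single i 1) c := by
      refine ⟨intervalIntegrable_const, fun r hr => (hcM r ⟨hr.1, hr.2.trans hs.2⟩).1, ?_⟩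
      simp only [hsum (fun j => X j _)]
      exact hsub hprim
    have hgood : GoodT M X a b δ p s (glueAt t u (fun _ => Pi.single i 1)) (glueAt t γ c) := by
      have h1 := hεη.trans_le (min_le_left _ _)
      have h2 := hεη.trans_le (min_le_right _ _)
      refine ⟨hg.1.trans hs.1, by linarith [hs.2], glue_traj hg.1 hs.1 hg.2.2.1 htr hc,
        by rw [glueAt_left hg.1]; exact hg.2.2.2.1, ?_⟩
      rw [glue_cost hg.1 hs.1 hg.2.2.1.1 intervalIntegrable_const]
      have h3 : ‖(Pi.single i 1 : Fin k → ℝ)‖ = 1 := by rw [Pi.norm_single]; simp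
      simp only [h3, intervalIntegral.integral_const, smul_eq_mul, mul_one]
      linarith [hs.2]
    have hle : (reach X a t u γ).map (J s : (Fin n → ℝ) →ₗ[ℝ] (Fin n → ℝ)) ≤
        reach X a s (glueAt t u (fun _ => Pi.single i 1)) (glueAt t γ c) := by
      rintro _ ⟨z, ⟨v, h, hv, h0, h1⟩, rfl⟩
      have hv2 : Vari X t s (fun _ => Pi.single i 1) c (fun _ => 0) (fun s => J s z) := by
        refine ⟨by simp, ?_⟩
        simp only [hsum (fun j => fderiv ℝ (X j) _ _)]
        simpa using hsub (hJ z)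
      refine ⟨_, _, glue_vari hg.1 hs.1 hv hv2 (by simp [hJ0, h1]), by rw [glueAt_left hg.1, h0], ?_⟩
      exact glueAt_right (by simp [hJ0, h1]) hs.1
    have hinj : Function.Injective (J s : (Fin n → ℝ) →ₗ[ℝ] (Fin n → ℝ)) := by
      intro z w hzw
      have h1 : (K s * J s) z = (K s * J s) w := congrArg (K s) hzw
      rw [hKJ s hs] at h1
      exact h1
    have hfr := LinearEquiv.finrank_eq (Submodule.equivMapOfInjective _ hinj (reach X a t u γ))
    have heq := Submodule.eq_of_le_of_finrank_le hle (by rw [← hfr]; exact hmax _ _ _ hgood)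
    have hmem := hPZ _ _ _ hgood (by rw [← heq, ← hfr])
    rw [← heq, glueAt_right hc hs.1] at hmem
    obtain ⟨z, hz, hz2⟩ := hmem
    have : K s (Z (c s)) = z := by
      rw [← hz2]
      exact congrArg (fun T => T z) (hKJ s hs)
    rw [this]; exact hz
  have htmem : t ∈ Icc t (t + ε) := ⟨le_rfl, htε.le⟩
  have hZd : HasDerivWithinAt (fun s => Z (c s)) (fderiv ℝ Z (γ t) (X i (γ t)))
      (Icc t (t + ε)) t := by
    have h1 := (hcM t htmem).2.hasDerivWithinAt (s := Icc t (t + ε))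
    rw [hc] at h1
    have h2 : HasFDerivAt Z (fderiv ℝ Z (γ t)) (c t) := by rw [hc]; exact hZ.hasFDerivAt hpt
    exact h2.comp_hasDerivWithinAt t h1
  have hd : HasDerivWithinAt (fun s => K s (Z (c s))) (lieB (X i) Z (γ t)) (Icc t (t + ε)) t := by
    have := hK.clm_apply hZd
    have e : lieB (X i) Z (γ t) = (-fderiv ℝ (X i) (c t)) (Z (c t)) +
        (K t) ((fderiv ℝ Z (γ t)) (X i (γ t))) := by
      rw [hK0, hc, neg_apply, one_apply_eq_self]
      unfold lieB
      abel
    rw [e]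
    exact this
  by_contra hnot
  obtain ⟨f, hf, hf2⟩ := Submodule.exists_le_ker_of_notMem hnot
  have hd2 := (LinearMap.toContinuousLinearMap f).hasFDerivAt.comp_hasDerivWithinAt t hd
  have hd3 : HasDerivWithinAt (fun _ => (0 : ℝ)) (f (lieB (X i) Z (γ t))) (Icc t (t + ε)) t := by
    refine hd2.congr (fun s hs => ?_) ?_
    · exact (hf2 (key s hs)).symm
    · exact (hf2 (key t htmem)).symm
  have := (uniqueDiffOn_Icc htε t htmem).eq_deriv _ hd3 (hasDerivWithinAt_const _ _ _)
  exact hf this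

end FlowSec

section CoreSec

open Set Filter Topology

set_option linter.unusedSectionVars false
set_option linter.unusedSimpArgs false

variable {n k : ℕ} {M : Set (Fin n → ℝ)} {X : Fin k → (Fin n → ℝ) → (Fin n → ℝ)}

/-- `Z` is tangent to the reachable space at all maximal admissible data. -/
def Tang (M : Set (Fin n → ℝ)) (X : Fin k → (Fin n → ℝ) → (Fin n → ℝ)) (a b δ : ℝ)
    (p : Fin n → ℝ) (r : ℕ) (Z : (Fin n → ℝ) → (Fin n → ℝ)) : Prop :=
  ∀ t u γ, GoodT M X a b δ p t u γ → Module.finrank ℝ (reach X a t u γ) = r →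
    Z (γ t) ∈ reach X a t u γ

lemma tang_base {a b δ : ℝ} {p : Fin n → ℝ} {r : ℕ}
    (hmax : ∀ t u γ, GoodT M X a b δ p t u γ → Module.finrank ℝ (reach X a t u γ) ≤ r) (i : Fin k) :
    Tang M X a b δ p r (X i) := by
  intro t u γ hg hr
  have htc : t < (t + b) / 2 := by linarith [hg.2.1]
  have hcb : (t + b) / 2 < b := by linarith [hg.2.1]
  obtain ⟨h1, h2⟩ := reach_zero_ext (X := X) hg.1 htc u γ
  have h3 := hmax _ _ _ (good_zero_ext htc hcb hg)
  have heq := Submodule.eq_of_le_of_finrank_le h1 (by rw [hr]; exact h3)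
  rw [heq]
  exact h2 i

lemma tang_bracket (hM : IsOpen M) (hX : ∀ i, Sm M (X i)) {a b δ : ℝ} {p : Fin n → ℝ} {r : ℕ}
    (hmax : ∀ t u γ, GoodT M X a b δ p t u γ → Module.finrank ℝ (reach X a t u γ) ≤ r) (i : Fin k)
    {Z : (Fin n → ℝ) → (Fin n → ℝ)} (hZ : Sm M Z) (h : Tang M X a b δ p r Z) :
    Tang M X a b δ p r (lieB (X i) Z) := by
  intro t u γ hg hr
  subst hr
  exact step_bracket hM hX hg i hmax hZ h

lemma tang_hull (hM : IsOpen M) (hX : ∀ i, Sm M (X i)) {a b δ : ℝ} {p : Fin n → ℝ} {r : ℕ}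
    (hmax : ∀ t u γ, GoodT M X a b δ p t u γ → Module.finrank ℝ (reach X a t u γ) ≤ r)
    {Y : (Fin n → ℝ) → (Fin n → ℝ)} (hY : LieHull (Set.range X) Y) :
    Sm M Y ∧ Tang M X a b δ p r Y ∧
      ∀ Z, Sm M Z → Tang M X a b δ p r Z → Tang M X a b δ p r (lieB Y Z) := by
  induction hY with
  | base h =>
    obtain ⟨i, rfl⟩ := h
    exact ⟨hX i, tang_base hmax i, fun Z hZ hT => tang_bracket hM hX hmax i hZ hT⟩
  | @br Y W _ _ ih1 ih2 =>
    obtain ⟨hY1, hY2, hY3⟩ := ih1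
    obtain ⟨hW1, hW2, hW3⟩ := ih2
    refine ⟨hY1.lieB hW1, hY3 W hW1 hW2, fun Z hZ hT t u γ hg hr => ?_⟩
    have hpt : γ t ∈ M := hg.2.2.1.2.1 t ⟨hg.1, le_rfl⟩
    have hJ : lieB Y (lieB W Z) (γ t) = lieB (lieB Y W) Z (γ t) + lieB W (lieB Y Z) (γ t) :=
      VectorField.leibniz_identity_lieBracket (𝕜 := ℝ) (n := ((⊤ : ℕ∞) : WithTop ℕ∞))
        (by rw [minSmoothness_of_isRCLikeNormedField]
            exact WithTop.coe_le_coe.2 (le_top : (2 : ℕ∞) ≤ ⊤))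
        (hY1 _ hpt) (hW1 _ hpt) (hZ _ hpt)
    have h1 := hY3 _ (hW1.lieB hZ) (hW3 Z hZ hT) t u γ hg hr
    have h2 := hW3 _ (hY1.lieB hZ) (hY3 Z hZ hT) t u γ hg hr
    have : lieB (lieB Y W) Z (γ t) = lieB Y (lieB W Z) (γ t) - lieB W (lieB Y Z) (γ t) := by
      rw [hJ]; abel
    rw [this]
    exact Submodule.sub_mem _ h1 h2

/-- Small controls with full rank. -/
theorem core (hM : IsOpen M) (hX : ∀ i, Sm M (X i)) (hbg : BracketGenerating M (Set.range X))
    {a b δ : ℝ} {p : Fin n → ℝ} (hp : p ∈ M) (hab : a < b) (hδ : 0 < δ) :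
    ∃ u γ, Traj M X a b u γ ∧ γ a = p ∧ ∫ s in a..b, ‖u s‖ < δ ∧
      ∀ z, ∃ v h, Vari X a b u γ v h ∧ h a = 0 ∧ h b = z := by
  classical
  let S : Set ℕ := {m | ∃ t u γ, GoodT M X a b δ p t u γ ∧ Module.finrank ℝ (reach X a t u γ) = m}
  have hne : S.Nonempty := ⟨_, a, fun _ => 0, fun _ => p,
    ⟨le_rfl, hab, Traj.const hp, rfl, by simpa using hδ⟩, rfl⟩
  have hbd : BddAbove S := ⟨n, by
    rintro m ⟨t, u, γ, _, rfl⟩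
    have := Submodule.finrank_le (reach X a t u γ)
    simpa using this⟩
  have hmem := Nat.sSup_mem hne hbd
  obtain ⟨t, u, γ, hg, hr⟩ := hmem
  have hmax : ∀ t u γ, GoodT M X a b δ p t u γ → Module.finrank ℝ (reach X a t u γ) ≤ sSup S :=
    fun t u γ h => le_csSup hbd ⟨t, u, γ, h, rfl⟩
  have hpt : γ t ∈ M := hg.2.2.1.2.1 t ⟨hg.1, le_rfl⟩
  have htop : reach X a t u γ = ⊤ := by
    rw [eq_top_iff, ← hbg _ hpt, Submodule.span_le]
    rintro v ⟨Z, hZ, rfl⟩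
    exact (tang_hull hM hX hmax hZ).2.1 t u γ hg hr
  have hext := (reach_zero_ext (X := X) hg.1 hg.2.1 u γ).1
  rw [htop, top_le_iff] at hext
  refine ⟨glueAt t u (fun _ => 0), glueAt t γ (fun _ => γ t), ?_, ?_, ?_, fun z => ?_⟩
  · exact glue_traj hg.1 hg.2.1.le hg.2.2.1 (Traj.const hpt) rfl
  · rw [glueAt_left hg.1]; exact hg.2.2.2.1
  · rw [glue_cost hg.1 hg.2.1.le hg.2.2.1.1 (by simp)]
    simpa using hg.2.2.2.2
  · have : z ∈ reach X a b (glueAt t u (fun _ => 0)) (glueAt t γ (fun _ => γ t)) := by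
      rw [hext]; trivial
    exact this

end CoreSec

/-! ### The operators entering the implicit function theorem -/

section NemSec

open Set Filter Topology

set_option linter.unusedSectionVars false
set_option linter.unusedSimpArgs false

variable {n k : ℕ}

/-- Pointwise application of a continuous family of operators. -/
def mulC (A : C(II, (Fin n → ℝ) →L[ℝ] (Fin n → ℝ))) : C(II, Fin n → ℝ) →L[ℝ] C(II, Fin n → ℝ) :=
  LinearMap.mkContinuous
    { toFun := fun h => ⟨fun t => A t (h t), A.continuous.clm_apply h.continuous⟩
      map_add' := fun h1 h2 => by ext1 t; simp
      map_smul' := fun a h => by ext1 t; simp }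
    ‖A‖ fun h => by
      refine (ContinuousMap.norm_le _ (by positivity)).2 fun t => ?_
      exact (A t).le_of_opNorm_le_of_le (A.norm_coe_le_norm t) (h.norm_coe_le_norm t)

lemma mulC_apply (A : C(II, (Fin n → ℝ) →L[ℝ] (Fin n → ℝ))) (h : C(II, Fin n → ℝ)) (t : II) :
    mulC A h t = A t (h t) := rfl

/-- The superposition operator is strictly differentiable. -/
lemma nem_strict {M : Set (Fin n → ℝ)} (hM : IsOpen M) (Y : C(Fin n → ℝ, Fin n → ℝ))
    (hY : Sm M Y) (γ : C(II, Fin n → ℝ)) (hγ : ∀ t, γ t ∈ M)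
    (A : C(II, (Fin n → ℝ) →L[ℝ] (Fin n → ℝ))) (hA : ∀ t, A t = fderiv ℝ Y (γ t)) :
    HasStrictFDerivAt (fun g : C(II, Fin n → ℝ) => Y.comp g) (mulC A) γ := by
  rw [hasStrictFDerivAt_iff_isLittleO, Asymptotics.isLittleO_iff]
  intro c hc
  have hK : IsCompact (range γ) := isCompact_range γ.continuous
  have hKM : range γ ⊆ M := by rintro _ ⟨t, rfl⟩; exact hγ t
  obtain ⟨δ1, hδ1, hth⟩ := hK.exists_thickening_subset_open hM hKM
  obtain ⟨δ2, hδ2, hu⟩ := Metric.mem_uniformity_dist.1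
    (hK.uniformContinuousAt_of_continuousAt (fderiv ℝ Y)
      (fun a ha => hY.continuousAt_fderiv (hKM ha)) (Metric.dist_mem_uniformity hc))
  have hδ : 0 < min δ1 δ2 := lt_min hδ1 hδ2
  have hb : Metric.ball γ (min δ1 δ2) ∈ 𝓝 γ := Metric.ball_mem_nhds _ hδ
  filter_upwards [prod_mem_nhds hb hb] with q hq
  refine (ContinuousMap.norm_le _ (by positivity)).2 fun t => ?_
  have hmem : ∀ g ∈ Metric.ball γ (min δ1 δ2), g t ∈ Metric.ball (γ t) (min δ1 δ2) := fun g hg =>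
    (ContinuousMap.dist_apply_le_dist t).trans_lt hg
  have := (convex_ball (γ t) (min δ1 δ2)).norm_image_sub_le_of_norm_hasFDerivWithin_le'
    (f := Y) (f' := fderiv ℝ Y) (φ := A t) (C := c) (𝕜 := ℝ) (fun z hz => ?_) (fun z hz => ?_)
    (hmem _ hq.2) (hmem _ hq.1)
  · refine this.trans (mul_le_mul_of_nonneg_left ?_ hc.le)
    exact (q.1 - q.2).norm_coe_le_norm t
  · refine (hY.hasFDerivAt (hth ?_)).hasFDerivWithinAt
    rw [Metric.mem_thickening_iff]
    exact ⟨γ t, ⟨t, rfl⟩, (Metric.mem_ball.1 hz).trans_le (min_le_left _ _)⟩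
  · have h1 := hu (a := γ t) (b := z)
      (by rw [dist_comm]; exact (Metric.mem_ball.1 hz).trans_le (min_le_right _ _)) ⟨t, rfl⟩
    simp only [] at h1
    rw [hA, ← dist_eq_norm, dist_comm]
    exact le_of_lt h1

lemma primC_apply {F : Type*} [NormedAddCommGroup F] [NormedSpace ℝ F] (g : ℝ → F)
    (hg : IntegrableOn g (Icc 0 1)) (t : II) : primC g hg t = ∫ x in (0 : ℝ)..t, g x := rfl

lemma lp_io (u : LpOne k) (i : Fin k) : IntegrableOn (fun s => u s i) (Icc 0 1) :=
  (L1.integrable_coeFn u).eval i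

lemma io_smul {G : Type*} [NormedAddCommGroup G] [NormedSpace ℝ G] {f : ℝ → ℝ}
    (hf : IntegrableOn f (Icc 0 1)) (g : C(II, G)) :
    IntegrableOn (fun s => f s • g (pr s)) (Icc 0 1) := by
  refine Integrable.mono' (hf.norm.mul_const ‖g‖) ?_ (Eventually.of_forall fun s => ?_)
  · exact hf.aestronglyMeasurable.smul (g.continuous.comp continuous_pr).aestronglyMeasurable
  · rw [norm_smul]
    exact mul_le_mul_of_nonneg_left (g.norm_coe_le_norm _) (norm_nonneg _)

lemma int_congr {F : Type*} [NormedAddCommGroup F] [NormedSpace ℝ F] {f g : ℝ → F}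
    (h : f =ᵐ[volume.restrict (Icc (0 : ℝ) 1)] g) {s t : ℝ}
    (hs : s ∈ Icc (0 : ℝ) 1) (ht : t ∈ Icc (0 : ℝ) 1) :
    ∫ x in s..t, f x = ∫ x in s..t, g x := by
  refine intervalIntegral.integral_congr_ae_restrict ?_
  refine ae_restrict_of_ae_restrict_of_subset ?_ h
  exact uIoc_subset_uIcc.trans (Set.uIcc_subset_Icc hs ht)

/-- The bilinear operator `(u, g) ↦ ∫₀ᵗ uᵢ g`. -/
def bilB (i : Fin k) : LpOne k →L[ℝ] C(II, Fin n → ℝ) →L[ℝ] C(II, Fin n → ℝ) :=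
  LinearMap.mkContinuous₂
    (LinearMap.mk₂ ℝ (fun (u : LpOne k) (g : C(II, Fin n → ℝ)) =>
        primC (fun s => u s i • g (pr s)) (io_smul (lp_io u i) g))
      (fun u u2 g => by
        ext1 t
        simp only [primC_apply, ContinuousMap.add_apply]
        rw [← intervalIntegral.integral_add (ii_of_io (io_smul (lp_io u i) g) (by simp) t.2)
          (ii_of_io (io_smul (lp_io u2 i) g) (by simp) t.2)]
        refine int_congr ?_ (by simp) t.2
        filter_upwards [Lp.coeFn_add u u2] with s hs
        rw [hs, Pi.add_apply, Pi.add_apply, add_smul])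
      (fun c u g => by
        ext1 t
        simp only [primC_apply, ContinuousMap.smul_apply]
        rw [← intervalIntegral.integral_smul]
        refine int_congr ?_ (by simp) t.2
        filter_upwards [Lp.coeFn_smul c u] with s hs
        rw [hs, Pi.smul_apply, Pi.smul_apply, smul_eq_mul, mul_smul])
      (fun u g g2 => by
        ext1 t
        simp only [primC_apply, ContinuousMap.add_apply, smul_add]
        exact intervalIntegral.integral_add (ii_of_io (io_smul (lp_io u i) g) (by simp) t.2)
          (ii_of_io (io_smul (lp_io u i) g2) (by simp) t.2))
      (fun c u g => by
        ext1 t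
        simp only [primC_apply, ContinuousMap.smul_apply]
        rw [← intervalIntegral.integral_smul]
        congr 1
        funext s
        exact smul_comm _ _ _))
    1 fun u g => by
      rw [one_mul]
      refine (ContinuousMap.norm_le _ (by positivity)).2 fun t => ?_
      simp only [LinearMap.mk₂_apply, primC_apply]
      have hi0 : IntegrableOn (fun s => ‖u s‖) (Icc 0 1) := (L1.integrable_coeFn u).norm
      have hi := ii_of_io hi0 (s := 0) (t := t) (by simp) t.2
      calc ‖∫ x in (0 : ℝ)..t, u x i • g (pr x)‖ ≤ ∫ x in (0 : ℝ)..t, ‖u x‖ * ‖g‖ := by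
            refine intervalIntegral.norm_integral_le_of_norm_le t.2.1
              (Eventually.of_forall fun s _ => ?_) (hi.mul_const _)
            rw [norm_smul]
            exact mul_le_mul (norm_le_pi_norm _ _) (g.norm_coe_le_norm _) (norm_nonneg _)
              (norm_nonneg _)
        _ = (∫ x in (0 : ℝ)..t, ‖u x‖) * ‖g‖ := intervalIntegral.integral_mul_const _ _
        _ ≤ (∫ x in (0 : ℝ)..1, ‖u x‖) * ‖g‖ := by
            refine mul_le_mul_of_nonneg_right ?_ (norm_nonneg _)
            exact intervalIntegral.integral_mono_interval le_rfl t.2.1 t.2.2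
              (Eventually.of_forall fun _ => norm_nonneg _) (ii_of_io hi0 (by simp) (by simp))
        _ = ‖u‖ * ‖g‖ := by
            rw [L1.norm_eq_integral_norm, intervalIntegral.integral_of_le zero_le_one,
              ← integral_Icc_eq_integral_Ioc]

lemma bilB_apply (i : Fin k) (u : LpOne k) (g : C(II, Fin n → ℝ)) (t : II) :
    bilB i u g t = ∫ s in (0 : ℝ)..t, u s i • g (pr s) := rfl

end NemSec

section IftSec

open Set Filter Topology

set_option linter.unusedSectionVars false
set_option linter.unusedSimpArgs false

variable {n k : ℕ} {M : Set (Fin n → ℝ)} {X : Fin k → (Fin n → ℝ) → (Fin n → ℝ)}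

lemma sum_int (u : LpOne k) (g : Fin k → C(II, Fin n → ℝ)) (t : II) :
    IntervalIntegrable (fun s => ∑ i, u s i • g i (pr s)) volume 0 (t : ℝ) ∧
    (∑ i, bilB i u (g i)) t = ∫ s in (0 : ℝ)..t, ∑ i, u s i • g i (pr s) := by
  have hi : ∀ i ∈ Finset.univ, IntervalIntegrable (fun s => u s i • g i (pr s)) volume 0 (t : ℝ) :=
    fun i _ => ii_of_io (io_smul (lp_io u i) (g i)) (by simp) t.2
  constructor
  · have h1 := IntervalIntegrable.sum Finset.univ (f := fun i s => u s i • g i (pr s)) hi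
    have e : (fun s => ∑ i, u s i • g i (pr s)) = ∑ i, fun s => u s i • g i (pr s) := by
      funext s; simp only [Finset.sum_apply]
    rw [e]; exact h1
  · rw [intervalIntegral.integral_finsetSum hi, ContinuousMap.sum_apply]
    exact Finset.sum_congr rfl fun i _ => bilB_apply i u (g i) t

lemma solves_iff (Y : Fin k → C(Fin n → ℝ, Fin n → ℝ)) (hYX : ∀ i, ∀ z ∈ M, Y i z = X i z)
    (x : Fin n → ℝ) (u : LpOne k) (γ : C(II, Fin n → ℝ)) (hγ : ∀ t, γ t ∈ M) :
    SolvesODE X u x γ ↔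
      γ - ContinuousMap.const _ x - ∑ i, bilB i u ((Y i).comp γ) = 0 := by
  have e : (fun s => ∑ i, u s i • X i (γ (Set.projIcc 0 1 zero_le_one s))) =
      fun s => ∑ i, u s i • ((Y i).comp γ) (pr s) := by
    funext s
    refine Finset.sum_congr rfl fun i _ => ?_
    rw [ContinuousMap.comp_apply, hYX i _ (hγ _)]
    rfl
  unfold SolvesODE
  rw [e]
  constructor
  · intro h
    ext1 t
    have h1 := (h t).2
    rw [ContinuousMap.sub_apply, ContinuousMap.sub_apply, (sum_int u _ t).2, h1]
    simp
  · intro h t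
    refine ⟨(sum_int u _ t).1, ?_⟩
    have h1 := congrArg (fun f : C(II, Fin n → ℝ) => f t) h
    simp only [ContinuousMap.sub_apply, (sum_int u _ t).2, ContinuousMap.const_apply,
      ContinuousMap.zero_apply] at h1
    rw [sub_sub, sub_eq_zero] at h1
    exact h1

set_option maxHeartbeats 1600000 in
/-- Local solvability, smooth dependence and the formula for the derivative. -/
theorem ift_pkg (hM : IsOpen M) (hX : ∀ i, Sm M (X i))
    (Y : Fin k → C(Fin n → ℝ, Fin n → ℝ)) (hYX : ∀ i, ∀ z ∈ M, Y i z = X i z)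
    (x : Fin n → ℝ) (u0 : LpOne k) (γ0 : C(II, Fin n → ℝ)) (hγ0 : ∀ t, γ0 t ∈ M)
    (hs : SolvesODE X u0 x γ0) :
    ∃ (ψ : LpOne k → C(II, Fin n → ℝ)) (ψ' : LpOne k →L[ℝ] C(II, Fin n → ℝ)),
      HasStrictFDerivAt ψ ψ' u0 ∧
      (∀ᶠ u in 𝓝 u0, (∀ t, ψ u t ∈ M) ∧ SolvesODE X u x (ψ u)) ∧
      ∀ (v : LpOne k) (h : C(II, Fin n → ℝ)),
        (∀ t : II, h t = ∫ s in (0 : ℝ)..t, ((∑ i, v s i • X i (γ0 (pr s))) +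
          ∑ i, u0 s i • fderiv ℝ (X i) (γ0 (pr s)) (h (pr s)))) → ψ' v = h := by
  have hev : ∀ i, ∀ z ∈ M, (Y i : (Fin n → ℝ) → (Fin n → ℝ)) =ᶠ[𝓝 z] X i := fun i z hz => by
    filter_upwards [hM.mem_nhds hz] with w hw using hYX i w hw
  have hYs : ∀ i, Sm M (Y i) := fun i z hz => (hX i z hz).congr_of_eventuallyEq (hev i z hz)
  have hfd : ∀ i, ∀ z ∈ M, fderiv ℝ (Y i) z = fderiv ℝ (X i) z := fun i z hz =>
    (hev i z hz).fderiv_eq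
  let A : Fin k → C(II, (Fin n → ℝ) →L[ℝ] (Fin n → ℝ)) := fun i =>
    ⟨fun t => fderiv ℝ (Y i) (γ0 t), continuous_iff_continuousAt.2 fun t =>
      ((hYs i).continuousAt_fderiv (hγ0 t)).comp γ0.continuous.continuousAt⟩
  have hN : ∀ i, HasStrictFDerivAt (fun g : C(II, Fin n → ℝ) => (Y i).comp g) (mulC (A i)) γ0 :=
    fun i => nem_strict hM (Y i) (hYs i) γ0 hγ0 (A i) fun t => rfl
  let Fm : LpOne k × C(II, Fin n → ℝ) → C(II, Fin n → ℝ) := fun q =>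
    q.2 - ContinuousMap.const _ x - ∑ i, bilB i q.1 ((Y i).comp q.2)
  have hfst : HasStrictFDerivAt (fun q : LpOne k × C(II, Fin n → ℝ) => q.1)
      (ContinuousLinearMap.fst ℝ (LpOne k) C(II, Fin n → ℝ)) (u0, γ0) := hasStrictFDerivAt_fst
  have hsnd : HasStrictFDerivAt (fun q : LpOne k × C(II, Fin n → ℝ) => q.2)
      (ContinuousLinearMap.snd ℝ (LpOne k) C(II, Fin n → ℝ)) (u0, γ0) := hasStrictFDerivAt_snd
  have hNs : ∀ i, HasStrictFDerivAt (fun q : LpOne k × C(II, Fin n → ℝ) => (Y i).comp q.2)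
      (mulC (A i) ∘L ContinuousLinearMap.snd ℝ (LpOne k) C(II, Fin n → ℝ)) (u0, γ0) := fun i =>
    HasStrictFDerivAt.comp (u0, γ0) (hN i) hsnd
  have hFm := (hsnd.sub_const (ContinuousMap.const II x)).fun_sub
    (HasStrictFDerivAt.fun_sum (u := Finset.univ) (fun i _ =>
      (bilB (n := n) (k := k) i).hasStrictFDerivAt_of_bilinear hfst (hNs i)))
  set F' := (ContinuousLinearMap.snd ℝ (LpOne k) C(II, Fin n → ℝ)) - ∑ i : Fin k,
    ((bilB (n := n) (k := k) i).precompR (LpOne k × C(II, Fin n → ℝ)) u0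
        (mulC (A i) ∘L ContinuousLinearMap.snd ℝ (LpOne k) C(II, Fin n → ℝ)) +
      (bilB (n := n) (k := k) i).precompL (LpOne k × C(II, Fin n → ℝ))
        (ContinuousLinearMap.fst ℝ (LpOne k) C(II, Fin n → ℝ)) ((Y i).comp γ0)) with hF'
  have hF : HasStrictFDerivAt Fm F' (u0, γ0) := hFm
  have hF'app : ∀ v h, F' (v, h) = h - ∑ i, (bilB i u0 (mulC (A i) h) + bilB i v ((Y i).comp γ0)) := by
    intro v h
    rw [hF']
    simp [ContinuousLinearMap.precompR_apply, ContinuousLinearMap.precompL_apply]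
  have hAk : IntegrableOn (fun s => ∑ i, u0 s i • A i (pr s)) (Icc 0 1) :=
    integrable_finsetSum _ fun i _ => io_smul (lp_io u0 i) (A i)
  have hinr : F' ∘L .inr ℝ (LpOne k) C(II, Fin n → ℝ) = 1 - volt _ hAk := by
    ext1 h
    ext1 t
    rw [ContinuousLinearMap.comp_apply, ContinuousLinearMap.inr_apply, hF'app]
    simp only [map_zero, zero_apply, add_zero, sub_apply, one_apply_eq_self, ContinuousMap.sub_apply,
      volt_apply]
    rw [(sum_int u0 (fun i => mulC (A i) h) t).2]
    simp only [mulC_apply, sum_apply, smul_apply]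
  have hinv : (F' ∘L .inr ℝ (LpOne k) C(II, Fin n → ℝ)).IsInvertible := by
    rw [hinr]
    obtain ⟨w, hw⟩ := isUnit_one_sub_volt _ hAk
    rw [← hw]
    exact ⟨ContinuousLinearEquiv.unitsEquiv ℝ _ w, rfl⟩
  have hF0 : Fm (u0, γ0) = 0 := (solves_iff Y hYX x u0 γ0 hγ0).1 hs
  refine ⟨hF.implicitFunctionOfProdDomain hinv, _,
    hF.hasStrictFDerivAt_implicitFunctionOfProdDomain hinv, ?_, ?_⟩
  · have hO : {g : C(II, Fin n → ℝ) | ∀ t, g t ∈ M} ∈ 𝓝 γ0 := by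
      have h1 : IsOpen {g : C(II, Fin n → ℝ) | MapsTo g univ M} :=
        ContinuousMap.isOpen_setOfPred_mapsTo isCompact_univ hM
      refine mem_of_superset (h1.mem_nhds fun t _ => hγ0 t) fun g hg t => hg (mem_univ t)
    filter_upwards [hF.eventually_apply_implicitFunctionOfProdDomain hinv,
      (hF.tendsto_implicitFunctionOfProdDomain hinv).eventually hO] with u h1 h2
    refine ⟨h2, (solves_iff Y hYX x u _ h2).2 ?_⟩
    rw [hF0] at h1
    exact h1
  · intro v h hh
    have e : F' (v, h) = 0 := by
      rw [hF'app]
      ext1 t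
      rw [Finset.sum_add_distrib, ContinuousMap.sub_apply, ContinuousMap.add_apply,
        (sum_int u0 (fun i => mulC (A i) h) t).2, (sum_int v (fun i => (Y i).comp γ0) t).2,
        ContinuousMap.zero_apply, hh t, sub_eq_zero,
        ← intervalIntegral.integral_add (sum_int u0 (fun i => mulC (A i) h) t).1
          (sum_int v (fun i => (Y i).comp γ0) t).1]
      congr 1
      funext s
      rw [add_comm]
      congr 1
      · refine Finset.sum_congr rfl fun i _ => ?_
        rw [mulC_apply, ← hfd i _ (hγ0 _)]
        rfl
      · refine Finset.sum_congr rfl fun i _ => ?_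
        rw [ContinuousMap.comp_apply, hYX i _ (hγ0 _)]
    have e2 : F' (v, h) = (F' ∘L .inl ℝ (LpOne k) C(II, Fin n → ℝ)) v +
        (F' ∘L .inr ℝ (LpOne k) C(II, Fin n → ℝ)) h := by
      rw [ContinuousLinearMap.comp_apply, ContinuousLinearMap.comp_apply, ← map_add]
      simp
    rw [neg_apply, ContinuousLinearMap.comp_apply, neg_eq_iff_eq_neg, hinv.inverse_apply_eq, map_neg]
    rw [e] at e2
    exact (eq_neg_of_add_eq_zero_left e2.symm)

end IftSec

section FinalSec

open Set Filter Topology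

set_option linter.unusedSectionVars false
set_option linter.unusedSimpArgs false

variable {n k : ℕ} {M : Set (Fin n → ℝ)} {X : Fin k → (Fin n → ℝ) → (Fin n → ℝ)}

lemma one_memII : (1 : ℝ) ∈ Icc (0 : ℝ) 1 := ⟨zero_le_one, le_rfl⟩
lemma zero_memII : (0 : ℝ) ∈ Icc (0 : ℝ) 1 := ⟨le_rfl, zero_le_one⟩

lemma io_of_ii {F : Type*} [NormedAddCommGroup F] {f : ℝ → F}
    (h : IntervalIntegrable f volume 0 1) : Integrable f (volume.restrict (Icc (0 : ℝ) 1)) :=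
  (intervalIntegrable_iff_integrableOn_Icc_of_le zero_le_one).1 h

lemma ii_of_Icc {F : Type*} [NormedAddCommGroup F] {f : ℝ → F}
    (h : Integrable f (volume.restrict (Icc (0 : ℝ) 1))) : IntervalIntegrable f volume 0 1 :=
  (intervalIntegrable_iff_integrableOn_Icc_of_le zero_le_one).2 h

/-- Restriction of a function continuous on `[0,1]`. -/
lemma exists_restr {γ : ℝ → Fin n → ℝ} (h : ContinuousOn γ (Icc 0 1)) :
    ∃ γC : C(II, Fin n → ℝ), ∀ t : II, γC t = γ t :=
  ⟨⟨fun t => γ t, continuousOn_iff_continuous_restrict.1 h⟩, fun _ => rfl⟩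

lemma exists_lp {w : ℝ → Fin k → ℝ} (h : IntervalIntegrable w volume 0 1) :
    ∃ U : LpOne k, U =ᵐ[volume.restrict (Icc (0 : ℝ) 1)] w :=
  ⟨(io_of_ii h).toL1 w, (io_of_ii h).coeFn_toL1⟩

lemma restr_pr {γ : ℝ → Fin n → ℝ} {γC : C(II, Fin n → ℝ)} (h : ∀ t : II, γC t = γ t) {s : ℝ}
    (hs : s ∈ Icc (0 : ℝ) 1) : γC (pr s) = γ s := by
  rw [h, pr_of_mem hs]

lemma traj_to_solves {x : Fin n → ℝ} {w : ℝ → Fin k → ℝ} {γ : ℝ → Fin n → ℝ}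
    (h : Traj M X 0 1 w γ) (h0 : γ 0 = x) {U : LpOne k} {γC : C(II, Fin n → ℝ)}
    (hU : U =ᵐ[volume.restrict (Icc (0 : ℝ) 1)] w) (hC : ∀ t : II, γC t = γ t) :
    (∀ t, γC t ∈ M) ∧ SolvesODE X U x γC := by
  have e : (fun s => ∑ i, w s i • X i (γ s)) =ᵐ[volume.restrict (Icc (0 : ℝ) 1)]
      (fun s => ∑ i, U s i • X i (γC (Set.projIcc 0 1 zero_le_one s))) := by
    filter_upwards [hU, ae_restrict_mem measurableSet_Icc] with s hs hs1
    rw [hs, ← restr_pr hC hs1]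
    rfl
  refine ⟨fun t => by rw [hC]; exact h.2.1 t t.2, fun t => ⟨?_, ?_⟩⟩
  · exact ii_sub (ii_of_Icc ((io_of_ii h.2.2.1).congr e)) zero_memII t.2
  · rw [← int_congr e zero_memII t.2, ← h.2.2.2 0 zero_memII t t.2, h0, hC]
    abel

lemma solves_to_traj {x : Fin n → ℝ} {U : LpOne k} {γC : C(II, Fin n → ℝ)}
    (hM : ∀ t, γC t ∈ M) (hs : SolvesODE X U x γC) :
    Traj M X 0 1 U (fun s => γC (pr s)) ∧ γC (pr 0) = x := by
  have h0 : γC (pr 0) = x := by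
    have := (hs (pr 0)).2
    rw [this, pr_of_mem zero_memII]
    simp
  refine ⟨⟨ii_of_Icc (L1.integrable_coeFn U), fun t _ => hM _, ?_⟩, h0⟩
  refine PrimOn.of_left (hs ⟨1, one_memII⟩).1 fun t ht => ?_
  have := (hs (pr t)).2
  simp only
  rw [h0, this, pr_of_mem ht]
  simp [pr]

lemma vari_to_eq {w v : ℝ → Fin k → ℝ} {γ h : ℝ → Fin n → ℝ} (hv : Vari X 0 1 w γ v h)
    (h0 : h 0 = 0) {U : LpOne k} {γC : C(II, Fin n → ℝ)}
    (hU : U =ᵐ[volume.restrict (Icc (0 : ℝ) 1)] w) (hC : ∀ t : II, γC t = γ t) :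
    ∃ (V : LpOne k) (hh : C(II, Fin n → ℝ)),
      (∀ t : II, hh t = ∫ s in (0 : ℝ)..t, ((∑ i, V s i • X i (γC (pr s))) +
          ∑ i, U s i • fderiv ℝ (X i) (γC (pr s)) (hh (pr s)))) ∧
      hh ⟨1, one_memII⟩ = h 1 := by
  obtain ⟨V, hV⟩ := exists_lp hv.1
  obtain ⟨hh, hhh⟩ := exists_restr (hv.2.continuousOn zero_le_one)
  refine ⟨V, hh, fun t => ?_, hhh _⟩
  have e : (fun s => (∑ i, v s i • X i (γ s)) + ∑ i, w s i • fderiv ℝ (X i) (γ s) (h s))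
      =ᵐ[volume.restrict (Icc (0 : ℝ) 1)]
      (fun s => (∑ i, V s i • X i (γC (pr s))) +
          ∑ i, U s i • fderiv ℝ (X i) (γC (pr s)) (hh (pr s))) := by
    filter_upwards [hU, hV, ae_restrict_mem measurableSet_Icc] with s hs hs2 hs1
    rw [hs, hs2, restr_pr hC hs1, restr_pr hhh hs1]
  rw [← int_congr e zero_memII t.2, ← hv.2.2 0 zero_memII t t.2, h0, hhh]
  abel

lemma cost_comp {a b m d : ℝ} (hm : m ≠ 0) (u : ℝ → Fin k → ℝ) :
    ∫ s in a..b, ‖m • u (m * s + d)‖ = (|m| * m⁻¹) * ∫ s in (m * a + d)..(m * b + d), ‖u s‖ := by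
  simp only [norm_smul, Real.norm_eq_abs]
  rw [intervalIntegral.integral_const_mul,
    intervalIntegral.integral_comp_mul_add (fun s => ‖u s‖) hm, smul_eq_mul, mul_assoc]

/-- Perturbation of a trajectory to a regular one with the same endpoint. -/
lemma perturb (hM : IsOpen M) (hX : ∀ i, Sm M (X i)) (hbg : BracketGenerating M (Set.range X))
    {u : ℝ → Fin k → ℝ} {γ : ℝ → Fin n → ℝ} (h : Traj M X 0 1 u γ) {η : ℝ} (hη : 0 < η) :
    ∃ w γ', Traj M X 0 1 w γ' ∧ γ' 0 = γ 0 ∧ γ' 1 = γ 1 ∧ ∫ s in (0 : ℝ)..1, ‖w s - u s‖ < η ∧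
      ∀ z, ∃ v h, Vari X 0 1 w γ' v h ∧ h 0 = 0 ∧ h 1 = z := by
  have hI : IntervalIntegrable (fun s => ‖u s‖) volume 0 1 := h.1.norm
  obtain ⟨a1, h01, h11, ha1⟩ : ∃ a, 0 < a ∧ a < 1 ∧ ∫ s in a..1, ‖u s‖ < η / 8 := by
    have hc : ContinuousOn (fun t => ∫ s in (0 : ℝ)..t, ‖u s‖) (Icc 0 1) := by
      have := intervalIntegral.continuousOn_primitive_interval (μ := volume) (a := 0) (b := 1)
        (f := fun s => ‖u s‖) (by rw [uIcc_of_le zero_le_one]; exact io_of_ii hI)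
      rwa [uIcc_of_le zero_le_one] at this
    have h1 := hc 1 one_memII
    have h2 : Tendsto (fun t => ∫ s in (0 : ℝ)..t, ‖u s‖) (𝓝[Ioo 0 1] 1)
        (𝓝 (∫ s in (0 : ℝ)..1, ‖u s‖)) :=
      h1.mono_left (nhdsWithin_mono _ Ioo_subset_Icc_self)
    have h3 := h2.eventually (lt_mem_nhds
      (show (∫ s in (0 : ℝ)..1, ‖u s‖) - η / 8 < ∫ s in (0 : ℝ)..1, ‖u s‖ by linarith))
    haveI : (𝓝[Ioo (0 : ℝ) 1] 1).NeBot := right_nhdsWithin_Ioo_neBot zero_lt_one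
    obtain ⟨a, ha, ha'⟩ := (h3.and self_mem_nhdsWithin).exists
    refine ⟨a, ha'.1, ha'.2, ?_⟩
    have h4 := intervalIntegral.integral_add_adjacent_intervals
      (ii_sub hI zero_memII ⟨ha'.1.le, ha'.2.le⟩) (ii_sub hI ⟨ha'.1.le, ha'.2.le⟩ one_memII)
    linarith
  obtain ⟨a2, h12, h21⟩ := exists_between h11
  obtain ⟨a3, h23, h31⟩ := exists_between h21
  have hp : γ a1 ∈ M := h.2.1 a1 ⟨h01.le, h11.le⟩
  obtain ⟨v, ξ, hT, hξ, hcost, hsurj⟩ := core hM hX hbg hp h12 (show 0 < η / 8 by linarith)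
  -- restriction of the given trajectory
  have hu1 : Traj M X 0 a1 u γ :=
    ⟨ii_sub h.1 zero_memII ⟨h01.le, h11.le⟩, fun t ht => h.2.1 t ⟨ht.1, ht.2.trans h11.le⟩,
      h.2.2.sub zero_memII ⟨h01.le, h11.le⟩⟩
  have hu2 : Traj M X a1 1 u γ :=
    ⟨ii_sub h.1 ⟨h01.le, h11.le⟩ one_memII, fun t ht => h.2.1 t ⟨h01.le.trans ht.1, ht.2⟩,
      h.2.2.sub ⟨h01.le, h11.le⟩ one_memII⟩
  -- reversed
  have p32 : 0 < a3 - a2 := by linarith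
  have p21 : 0 < a2 - a1 := by linarith
  have p13 : 0 < 1 - a3 := by linarith
  have p11 : 0 < 1 - a1 := by linarith
  obtain ⟨m, d, hm, e2, e3⟩ : ∃ m d : ℝ, m < 0 ∧ m * a2 + d = a2 ∧ m * a3 + d = a1 :=
    ⟨-((a2 - a1) / (a3 - a2)), a2 + (a2 - a1) / (a3 - a2) * a2,
      neg_lt_zero.2 (div_pos p21 p32), by ring, by field_simp; ring⟩
  obtain ⟨m', d', hm', e3', e1'⟩ : ∃ m d : ℝ, 0 < m ∧ m * a3 + d = a1 ∧ m * 1 + d = 1 :=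
    ⟨(1 - a1) / (1 - a3), a1 - (1 - a1) / (1 - a3) * a3, div_pos p11 p13, by ring,
      by field_simp; ring⟩
  have hR := Traj.comp (d := d) hm.ne hT h23.le (fun s hs => by
    constructor
    · rw [← e3]; nlinarith [hs.1, hs.2]
    · conv_rhs => rw [← e2]
      nlinarith [hs.1, hs.2])
  have hS := Traj.comp (d := d') hm'.ne' hu2 h31.le (fun s hs => by
    constructor
    · conv_lhs => rw [← e3']
      nlinarith [hs.1, hs.2]
    · conv_rhs => rw [← e1']
      nlinarith [hs.1, hs.2])
  have cR : ∫ s in a2..a3, ‖m • v (m * s + d)‖ < η / 8 := by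
    rw [cost_comp hm.ne, e2, e3, abs_of_neg hm, intervalIntegral.integral_symm]
    have : -m * m⁻¹ = -1 := by rw [neg_mul, mul_inv_cancel₀ hm.ne]
    rw [this]; linarith
  have cS : ∫ s in a3..1, ‖m' • u (m' * s + d')‖ < η / 8 := by
    rw [cost_comp hm'.ne', e3', e1', abs_of_pos hm', mul_inv_cancel₀ hm'.ne', one_mul]
    exact ha1
  have j3 : (fun s => γ (m' * s + d')) a3 = (fun s => ξ (m * s + d)) a3 := by
    simp only [e3, e3', hξ]
  have hTail := glue_traj h23.le h31.le hR hS j3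
  have cTail := glue_cost h23.le h31.le hR.1 hS.1
  set w3 := glueAt a3 (fun s => m • v (m * s + d)) (fun s => m' • u (m' * s + d'))
  set γ3 := glueAt a3 (fun s => ξ (m * s + d)) (fun s => γ (m' * s + d')) with hγ3
  have g31 : γ3 1 = γ 1 := by rw [hγ3, glueAt_right j3 h31.le, e1']
  have g32 : γ3 a2 = ξ a2 := by rw [hγ3, glueAt_left h23.le, e2]
  have hMid := glue_traj h12.le h21.le hT hTail g32
  have cMid := glue_cost h12.le h21.le hT.1 hTail.1
  set w2 := glueAt a2 v w3
  set γ2 := glueAt a2 ξ γ3 with hγ2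
  have g21 : γ2 a1 = γ a1 := by rw [hγ2, glueAt_left h12.le, hξ]
  have g22 : γ2 1 = γ 1 := by rw [hγ2, glueAt_right g32 h21.le, g31]
  have hAll := glue_traj h01.le h11.le hu1 hMid g21
  refine ⟨_, _, hAll, glueAt_left h01.le, ?_, ?_, ?_⟩
  · rw [glueAt_right g21 h11.le, g22]
  · have e : (fun s => ‖glueAt a1 u w2 s - u s‖) =
        fun s => ‖glueAt a1 (fun _ => (0 : Fin k → ℝ)) (fun s => w2 s - u s) s‖ := by
      funext s
      unfold glueAt
      split_ifs <;> simp
    rw [e, glue_cost h01.le h11.le (by simp) (hMid.1.sub hu2.1)]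
    have hle : ∫ s in a1..1, ‖w2 s - u s‖ ≤ ∫ s in a1..1, (‖w2 s‖ + ‖u s‖) :=
      intervalIntegral.integral_mono_on h11.le (hMid.1.sub hu2.1).norm
        (hMid.1.norm.add hu2.1.norm) fun s _ => norm_sub_le _ _
    rw [intervalIntegral.integral_add hMid.1.norm hu2.1.norm] at hle
    simp only [norm_zero, intervalIntegral.integral_zero]
    linarith
  · intro z
    obtain ⟨q, hq, hq1⟩ := hTail.transport h21 hX z
    obtain ⟨v', h', hv', hv0, hv1⟩ := hsurj (q a2)
    have V1 := glue_vari h12.le h21.le hv' hq hv1.symm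
    have r0 : glueAt a2 h' q a1 = (fun _ => (0 : Fin n → ℝ)) a1 := by
      rw [glueAt_left h12.le, hv0]
    have V2 := glue_vari h01.le h11.le (vari_zero 0 a1 u γ) V1 r0
    refine ⟨_, _, V2, glueAt_left h01.le, ?_⟩
    rw [glueAt_right r0 h11.le, glueAt_right hv1.symm h21.le, hq1]

end FinalSec

theorem endpoint_map_open_and_max_rank {n k : ℕ} (M : Set (Fin n → ℝ)) (hMopen : IsOpen M)
    (hMconn : IsConnected M) (X : Fin k → (Fin n → ℝ) → (Fin n → ℝ))
    (hXsmooth : ∀ i, ContDiffOn ℝ (⊤ : ℕ∞) (X i) M)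
    (K L : ℝ) (hK : ∀ i, ∀ x ∈ M, ‖X i x‖ ≤ K)
    (hL : ∀ i, ∀ x ∈ M, ∀ y ∈ M, ‖X i x - X i y‖ ≤ L * ‖x - y‖)
    (hbg : BracketGenerating M (Set.range X))
    (x : Fin n → ℝ) (hx : x ∈ M)
    (D : Set (LpOne k))
    (hD : D = {u : LpOne k | ∃ γ : C(Set.Icc (0 : ℝ) 1, Fin n → ℝ),
      (∀ t, γ t ∈ M) ∧ SolvesODE X (⇑u) x γ})
    (En : LpOne k → Fin n → ℝ)
    (hEn : ∀ (u : LpOne k) (γ : C(Set.Icc (0 : ℝ) 1, Fin n → ℝ)),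
      (∀ t, γ t ∈ M) → SolvesODE X (⇑u) x γ →
        En u = γ ⟨1, Set.mem_Icc.mpr ⟨zero_le_one, le_rfl⟩⟩) :
    IsOpen D ∧ (∀ V : Set (LpOne k), V ⊆ D → IsOpen V → IsOpen (En '' V)) ∧
      ∃ u ∈ D, Function.Surjective (fderiv ℝ En u) := by
  have hX : ∀ i, Sm M (X i) := fun i y hy => (hXsmooth i).contDiffAt (hMopen.mem_nhds hy)
  have hYex : ∀ i, ∃ Y : C(Fin n → ℝ, Fin n → ℝ), ∀ z ∈ M, Y z = X i z := by
    intro i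
    have hl : LipschitzOnWith L.toNNReal (X i) M := by
      refine LipschitzOnWith.of_dist_le_mul fun y hy z hz => ?_
      rw [dist_eq_norm, dist_eq_norm]
      refine (hL i y hy z hz).trans ?_
      gcongr
      exact Real.le_coe_toNNReal L
    obtain ⟨g, hg, hgX⟩ := hl.extend_pi
    exact ⟨⟨g, hg.continuous⟩, fun z hz => (hgX hz).symm⟩
  choose Y hYX using hYex
  -- differentiability package
  have pkg : ∀ (U : LpOne k) (γ0 : C(II, Fin n → ℝ)), (∀ t, γ0 t ∈ M) → SolvesODE X U x γ0 →
      D ∈ nhds U ∧ ∃ E' : LpOne k →L[ℝ] (Fin n → ℝ), HasStrictFDerivAt En E' U ∧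
      ∀ (v : LpOne k) (h : C(II, Fin n → ℝ)),
        (∀ t : II, h t = ∫ s in (0 : ℝ)..t, ((∑ i, v s i • X i (γ0 (pr s))) +
          ∑ i, U s i • fderiv ℝ (X i) (γ0 (pr s)) (h (pr s)))) → E' v = h ⟨1, one_memII⟩ := by
    intro U γ0 h1 h2
    obtain ⟨ψ, ψ', hψ, hev, hv⟩ := ift_pkg hMopen hX Y hYX x U γ0 h1 h2
    refine ⟨?_, (ContinuousMap.evalCLM ℝ (⟨1, one_memII⟩ : II)).comp ψ', ?_, ?_⟩
    · filter_upwards [hev] with u hu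
      rw [hD]; exact ⟨ψ u, hu⟩
    · refine HasStrictFDerivAt.congr_of_eventuallyEq
        ((ContinuousLinearMap.hasStrictFDerivAt _).comp U hψ) ?_
      filter_upwards [hev] with u hu
      exact (hEn u (ψ u) hu.1 hu.2).symm
    · intro v h hh
      rw [ContinuousLinearMap.comp_apply, hv v h hh]
      rfl
  -- regular trajectories give surjective derivatives
  have reg : ∀ (w : ℝ → Fin k → ℝ) (γ : ℝ → Fin n → ℝ), Traj M X 0 1 w γ → γ 0 = x →
      (∀ z, ∃ v h, Vari X 0 1 w γ v h ∧ h 0 = 0 ∧ h 1 = z) →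
      ∃ U : LpOne k, U =ᵐ[volume.restrict (Set.Icc (0 : ℝ) 1)] w ∧ U ∈ D ∧ En U = γ 1 ∧
        ∃ E' : LpOne k →L[ℝ] (Fin n → ℝ), HasStrictFDerivAt En E' U ∧ Function.Surjective E' := by
    intro w γ hT h0 hs
    obtain ⟨U, hU⟩ := exists_lp hT.1
    obtain ⟨γC, hC⟩ := exists_restr (hT.continuousOn zero_le_one)
    obtain ⟨s1, s2⟩ := traj_to_solves hT h0 hU hC
    obtain ⟨_, E', hE, hE'⟩ := pkg U γC s1 s2
    refine ⟨U, hU, by rw [hD]; exact ⟨γC, s1, s2⟩, ?_, E', hE, fun z => ?_⟩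
    · rw [hEn U γC s1 s2, hC]
    · obtain ⟨v, h, hv, hv0, hv1⟩ := hs z
      obtain ⟨V, hh, a, b⟩ := vari_to_eq hv hv0 hU hC
      exact ⟨V, by rw [hE' V hh a, b, hv1]⟩
  refine ⟨isOpen_iff_mem_nhds.2 fun U hU => ?_, fun V hVD hV => isOpen_iff_mem_nhds.2 ?_, ?_⟩
  · rw [hD] at hU
    obtain ⟨γ, h1, h2⟩ := hU
    exact (pkg U γ h1 h2).1
  · rintro _ ⟨u, hu, rfl⟩
    have huD := hVD hu
    rw [hD] at huD
    obtain ⟨γ, h1, h2⟩ := huD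
    obtain ⟨η, hη, hball⟩ := Metric.isOpen_iff.1 hV u hu
    obtain ⟨hT, h0⟩ := solves_to_traj h1 h2
    obtain ⟨w, γ', hT', g0, g1, hc, hs⟩ := perturb hMopen hX hbg hT hη
    obtain ⟨U, hU, hUD, hUE, E', hE, hE'⟩ := reg w γ' hT' (g0.trans h0) hs
    have hend : En U = En u := by
      rw [hUE, g1, hEn u γ h1 h2, pr_of_mem one_memII]
    have hUV : U ∈ V := by
      apply hball
      rw [Metric.mem_ball, dist_eq_norm, L1.norm_eq_integral_norm]
      refine lt_of_le_of_lt (le_of_eq ?_) hc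
      rw [intervalIntegral.integral_of_le zero_le_one, ← integral_Icc_eq_integral_Ioc]
      refine integral_congr_ae ?_
      filter_upwards [hU, Lp.coeFn_sub U u] with s hs1 hs2
      rw [hs2, Pi.sub_apply, hs1]
    rw [← hend, ← hE.map_nhds_eq_of_surj (LinearMap.range_eq_top.2 hE')]
    exact Filter.image_mem_map (hV.mem_nhds hUV)
  · obtain ⟨w, γ, hT, h0, _, hs⟩ := core hMopen hX hbg hx zero_lt_one (zero_lt_one (α := ℝ))
    obtain ⟨U, _, hUD, _, E', hE, hE'⟩ := reg w γ hT h0 hs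
    exact ⟨U, hUD, by rw [hE.hasFDerivAt.fderiv]; exact hE'⟩
end
end
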